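/- arXiv:2001.03794 — 15 statements merged into one kernel-verified Lean document; each statement's English description precedes it below -/
import Mathlib

section
/- If u and v are distinct false twins in a graph G, i.e., N_G(u) = N_G(v) (open neighborhoods, so in particular u and v are non-adjacent), then Γ(G) = Γ(G − v), where G − v is the graph obtained from G by deleting the vertex v. -/
/-- A Grundy coloring of order `k`: a proper coloring with colors `1, …, k`, all color
classes nonempty, such that every vertex colored `i` has, for each `j < i` (with `j ≥ 1`),
a neighbor colored `j`. -/
def IsGrundyColoring {V : Type*} (G : SimpleGraph V) (k : ℕ) (c : V → ℕ) : Prop :=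
  (∀ v, 1 ≤ c v ∧ c v ≤ k) ∧
  (∀ i, 1 ≤ i → i ≤ k → ∃ v, c v = i) ∧
  (∀ ⦃u v⦄, G.Adj u v → c u ≠ c v) ∧
  (∀ v j, 1 ≤ j → j < c v → ∃ u, G.Adj u v ∧ c u = j)

/-- The Grundy number `Γ(G)`: the largest `k` such that `G` admits a Grundy coloring of
order `k`. -/
noncomputable def grundyNumber {V : Type*} (G : SimpleGraph V) : ℕ :=
  sSup {k | ∃ c : V → ℕ, IsGrundyColoring G k c}

/-- In a Grundy coloring, a vertex whose neighborhood is contained in that of `v` does not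
receive a larger color than `v`. -/
theorem IsGrundyColoring.le_of_neighborSet_subset {V : Type*} {G : SimpleGraph V} {k : ℕ}
    {c : V → ℕ} (hc : IsGrundyColoring G k c) {u v : V}
    (h : G.neighborSet u ⊆ G.neighborSet v) : c u ≤ c v := by
  by_contra! hlt
  obtain ⟨w, hw, hwc⟩ := hc.2.2.2 u (c v) (hc.1 v).1 hlt
  exact hc.2.2.1 (h hw.symm) hwc.symm

/-- Grundy colorings pull back along surjections that preserve and reflect adjacency. -/
theorem IsGrundyColoring.comp {V W : Type*} {G : SimpleGraph V} {H : SimpleGraph W} {k : ℕ}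
    {c : W → ℕ} (hc : IsGrundyColoring H k c) {r : V → W} (hr : Function.Surjective r)
    (hadj : ∀ a b, H.Adj (r a) (r b) ↔ G.Adj a b) : IsGrundyColoring G k (c ∘ r) := by
  refine ⟨fun a => hc.1 (r a), fun i h1 hk => ?_, fun a b hab => hc.2.2.1 ((hadj a b).2 hab),
    fun a j h1 hj => ?_⟩
  · obtain ⟨w, hw⟩ := hc.2.1 i h1 hk
    obtain ⟨a, rfl⟩ := hr w
    exact ⟨a, hw⟩
  · obtain ⟨w, hw, hwc⟩ := hc.2.2.2 (r a) j h1 hj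
    obtain ⟨b, rfl⟩ := hr w
    exact ⟨b, (hadj b a).1 hw, hwc⟩

/-- A Grundy coloring that is constant on the fibers of a surjection preserving and reflecting
adjacency restricts along any section of that surjection. -/
theorem IsGrundyColoring.of_comp {V W : Type*} {G : SimpleGraph V} {H : SimpleGraph W} {k : ℕ}
    {c : W → ℕ} {r : V → W} (hc : IsGrundyColoring G k (c ∘ r)) (hr : Function.Surjective r)
    (hadj : ∀ a b, H.Adj (r a) (r b) ↔ G.Adj a b) : IsGrundyColoring H k c := by
  obtain ⟨hbound, hsurj, hproper, hgreedy⟩ := hc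
  refine ⟨hr.forall.2 hbound, fun i h1 hk => ?_,
    hr.forall₂.2 fun a b hab => hproper ((hadj a b).1 hab), hr.forall.2 fun a j h1 hj => ?_⟩
  · obtain ⟨a, ha⟩ := hsurj i h1 hk
    exact ⟨r a, ha⟩
  · obtain ⟨b, hb, hbc⟩ := hgreedy a j h1 hj
    exact ⟨r b, (hadj b a).2 hb, hbc⟩

/-- If `u ≠ v` are false twins of `G` (equal open neighborhoods), then
`Γ(G) = Γ(G − v)`. -/
theorem stmt_2 {V : Type*} [Fintype V] (G : SimpleGraph V) (u v : V)
    (huv : u ≠ v) (htwin : G.neighborSet u = G.neighborSet v) :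
    grundyNumber G = grundyNumber (G.induce {w | w ≠ v}) := by
  classical
  have htw : ∀ w, G.Adj u w ↔ G.Adj v w := fun w => Set.ext_iff.1 htwin w
  have htw' : ∀ w, G.Adj w u ↔ G.Adj w v := fun w => by
    rw [G.adj_comm w u, G.adj_comm w v, htw]
  let r : V → {w | w ≠ v} := fun w => if h : w = v then ⟨u, huv⟩ else ⟨w, h⟩
  have hr_val : ∀ w, (r w : V) = if w = v then u else w := fun w => by
    by_cases h : w = v <;> simp [r, h]
  have hr : Function.Surjective r := fun w =>
    ⟨w, Subtype.ext ((hr_val w).trans (if_neg w.2))⟩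
  have hadj : ∀ a b, (G.induce {w | w ≠ v}).Adj (r a) (r b) ↔ G.Adj a b := fun a b => by
    rw [SimpleGraph.comap_adj]
    simp only [Function.Embedding.subtype_apply, hr_val]
    split_ifs with ha hb hb <;> simp [*]
  unfold grundyNumber
  congr 1
  ext k
  refine ⟨fun ⟨c, hc⟩ => ⟨c ∘ Subtype.val, ?_⟩, fun ⟨c, hc⟩ => ⟨c ∘ r, hc.comp hr hadj⟩⟩
  have hcuv : c u = c v := le_antisymm (hc.le_of_neighborSet_subset htwin.subset)
    (hc.le_of_neighborSet_subset htwin.superset)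
  have hcr : (c ∘ Subtype.val) ∘ r = c := funext fun w => by
    by_cases h : w = v <;> simp [hr_val, h, hcuv]
  exact IsGrundyColoring.of_comp (hcr.symm ▸ hc) hr hadj
end

section
/- Let G be a graph and let u ≠ v be false twins of G, i.e., N_G(u) = N_G(v). Then in every Grundy coloring of G (of any order), the vertices u and v belong to the same color class. -/
/-- If `u ≠ v` are false twins of `G` (equal open neighborhoods), then in every Grundy
coloring of `G`, the vertices `u` and `v` get the same color. -/
theorem stmt_3 {V : Type*} (G : SimpleGraph V) (u v : V) (huv : u ≠ v)
    (htwin : G.neighborSet u = G.neighborSet v) (k : ℕ) (c : V → ℕ)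
    (hc : IsGrundyColoring G k c) : c u = c v := by
  have color_le : ∀ {a b : V}, G.neighborSet a = G.neighborSet b → c a ≤ c b := by
    intro a b hab
    by_contra! hlt
    obtain ⟨w, hw, hwc⟩ := hc.2.2.2 a (c b) (hc.1 b).1 hlt
    have hbw : w ∈ G.neighborSet b := hab ▸ hw.symm
    exact hc.2.2.1 hbw hwc.symm
  exact le_antisymm (color_le htwin) (color_le htwin.symm)
end

section
/- Let G be a graph, let H = G[W] be an induced subgraph of G on a vertex set W ⊆ V(G), and let s be a positive integer such that every vertex of the open neighborhood N_G(W) (the vertices outside W having a neighbor in W) has degree at most s in G. Then in every Grundy coloring of G, no vertex of W receives a color higher than Γ(H) + s. -/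
/-- `c` restricts to a Grundy coloring of the subgraph induced on `S`: it is proper there with
positive colors, and every vertex of `S` sees each smaller color inside `S`. -/
structure IsGrundyOn {V : Type*} (G : SimpleGraph V) (S : Set V) (c : V → ℕ) : Prop where
  pos : ∀ v ∈ S, 1 ≤ c v
  proper : ∀ u ∈ S, ∀ v ∈ S, G.Adj u v → c u ≠ c v
  exists_adj : ∀ v ∈ S, ∀ j, 1 ≤ j → j < c v → ∃ u ∈ S, G.Adj u v ∧ c u = j

/-- A Grundy coloring of an induced subgraph extends greedily to one more vertex. -/
theorem IsGrundyOn.exists_insert {V : Type*} [Finite V] {G : SimpleGraph V} {S : Set V}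
    {c : V → ℕ} (h : IsGrundyOn G S c) {v : V} (hv : v ∉ S) :
    ∃ c' : V → ℕ, IsGrundyOn G (insert v S) c' ∧ Set.EqOn c' c S := by
  classical
  have hex : ∃ m, 1 ≤ m ∧ ∀ u ∈ S, G.Adj u v → c u ≠ m := by
    obtain ⟨B, hB⟩ := (Set.finite_range c).bddAbove
    refine ⟨B + 1, by omega, fun u _ _ => ?_⟩
    have : c u ≤ B := hB ⟨u, rfl⟩
    omega
  obtain ⟨hm1, hm⟩ := Nat.find_spec hex
  have hmin : ∀ j, 1 ≤ j → j < Nat.find hex → ∃ u ∈ S, G.Adj u v ∧ c u = j := by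
    intro j hj hlt
    have := Nat.find_min hex hlt
    push Not at this
    exact this hj
  have hne : ∀ u ∈ S, Function.update c v (Nat.find hex) u = c u := fun u hu =>
    Function.update_of_ne (ne_of_mem_of_not_mem hu hv) _ _
  refine ⟨Function.update c v (Nat.find hex), ⟨?_, ?_, ?_⟩, hne⟩
  · rintro u (rfl | hu)
    · simpa only [Function.update_self] using hm1
    · rw [hne u hu]
      exact h.pos u hu
  · rintro u (rfl | hu) w (rfl | hw) hadj
    · exact absurd hadj (G.loopless.irrefl _)
    · rw [hne w hw, Function.update_self]
      exact (hm w hw hadj.symm).symm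
    · rw [hne u hu, Function.update_self]
      exact hm u hu hadj
    · rw [hne u hu, hne w hw]
      exact h.proper u hu w hw hadj
  · rintro u (rfl | hu) j hj hlt
    · rw [Function.update_self] at hlt
      obtain ⟨x, hx, hadj, hcx⟩ := hmin j hj hlt
      exact ⟨x, Or.inr hx, hadj, (hne x hx).trans hcx⟩
    · rw [hne u hu] at hlt
      obtain ⟨x, hx, hadj, hcx⟩ := h.exists_adj u hu j hj hlt
      exact ⟨x, Or.inr hx, hadj, (hne x hx).trans hcx⟩

/-- A Grundy coloring of an induced subgraph of a finite graph extends to the whole graph. -/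
theorem IsGrundyOn.exists_univ {V : Type*} [Finite V] {G : SimpleGraph V} {S : Set V}
    {c : V → ℕ} (h : IsGrundyOn G S c) :
    ∃ c' : V → ℕ, IsGrundyOn G Set.univ c' ∧ Set.EqOn c' c S := by
  have key : ∀ T : Set V, T.Finite → ∃ c' : V → ℕ, IsGrundyOn G (T ∪ S) c' ∧ Set.EqOn c' c S := by
    intro T hT
    induction T, hT using Set.Finite.induction_on with
    | empty => exact ⟨c, by simpa only [Set.empty_union] using h, fun _ _ => rfl⟩
    | @insert v T _ _ ih =>
      obtain ⟨c', hc', heq⟩ := ih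
      rw [Set.insert_union]
      by_cases hv : v ∈ T ∪ S
      · exact ⟨c', by rwa [Set.insert_eq_of_mem hv], heq⟩
      · obtain ⟨d, hd, hdeq⟩ := hc'.exists_insert hv
        exact ⟨d, hd, fun u hu => (hdeq (Or.inr hu)).trans (heq hu)⟩
  simpa only [Set.univ_union] using key Set.univ Set.finite_univ

/-- The order of a Grundy coloring of a finite graph is at most the number of vertices. -/
theorem IsGrundyColoring.le_card {V : Type*} [Finite V] {G : SimpleGraph V} {k : ℕ} {c : V → ℕ}
    (h : IsGrundyColoring G k c) : k ≤ Nat.card V := by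
  have hsub : Set.Icc 1 k ⊆ Set.range c := fun i hi => h.2.1 i hi.1 hi.2
  have hle := Set.ncard_le_ncard hsub (Set.finite_range c)
  rw [← Set.image_univ] at hle
  have hle' := Set.ncard_image_le (f := c) (Set.finite_univ (α := V))
  rw [Set.ncard_univ] at hle'
  have hcard : (Set.Icc 1 k).ncard = k := by
    rw [← Finset.coe_Icc, Set.ncard_coe_finset, Nat.card_Icc]
    omega
  omega

/-- The order of a Grundy coloring of a finite graph is at most its Grundy number. -/
theorem IsGrundyColoring.le_grundyNumber {V : Type*} [Finite V] {G : SimpleGraph V} {k : ℕ}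
    {c : V → ℕ} (h : IsGrundyColoring G k c) : k ≤ grundyNumber G :=
  le_csSup ⟨Nat.card V, fun _ ⟨_, hd⟩ => hd.le_card⟩ ⟨c, h⟩

/-- Colors in a Grundy coloring of an induced subgraph are bounded by the Grundy number of the
whole graph. -/
theorem IsGrundyOn.le_grundyNumber {V : Type*} [Finite V] {G : SimpleGraph V} {S : Set V}
    {c : V → ℕ} (h : IsGrundyOn G S c) {w : V} (hw : w ∈ S) : c w ≤ grundyNumber G := by
  obtain ⟨d, hd, heq⟩ := h.exists_univ
  have : Nonempty V := ⟨w⟩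
  obtain ⟨t, ht⟩ := Finite.exists_max d
  have hG : IsGrundyColoring G (d t) d := by
    refine ⟨fun v => ⟨hd.pos v trivial, ht v⟩, fun i hi hit => ?_,
      fun u v => hd.proper u trivial v trivial, fun v j hj hlt => ?_⟩
    · rcases hit.eq_or_lt with rfl | hlt
      · exact ⟨t, rfl⟩
      · obtain ⟨u, -, -, hu⟩ := hd.exists_adj t trivial i hi hlt
        exact ⟨u, hu⟩
    · obtain ⟨u, -, hu⟩ := hd.exists_adj v trivial j hj hlt
      exact ⟨u, hu⟩
  rw [← heq hw]
  exact (ht w).trans hG.le_grundyNumber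

/-- In a Grundy coloring, a vertex of degree at most `s` that has a neighbor with color above `s`
has color at most `s` itself. -/
theorem IsGrundyColoring.le_of_ncard_neighborSet_le {V : Type*} [Finite V] {G : SimpleGraph V}
    {k s : ℕ} {c : V → ℕ} (h : IsGrundyColoring G k c) {x w : V}
    (hdeg : (G.neighborSet x).ncard ≤ s) (hadj : G.Adj x w) (hw : s < c w) : c x ≤ s := by
  by_contra! hx
  have hsub : ((insert (c w) (Finset.Icc 1 s) : Finset ℕ) : Set ℕ) ⊆ c '' G.neighborSet x := by
    intro i hi
    rw [Finset.mem_coe, Finset.mem_insert, Finset.mem_Icc] at hi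
    rcases hi with rfl | ⟨hi1, his⟩
    · exact ⟨w, hadj, rfl⟩
    · obtain ⟨u, hu, rfl⟩ := h.2.2.2 x i hi1 (by omega)
      exact ⟨u, hu.symm, rfl⟩
  have hle := Set.ncard_le_ncard hsub (Set.toFinite _)
  rw [Set.ncard_coe_finset, Finset.card_insert_of_notMem (by simp [hw]), Nat.card_Icc] at hle
  have := Set.ncard_image_le (f := c) (G.neighborSet x).toFinite
  omega

/-- If every vertex of the open neighborhood of `W` in `G` has degree at most `s`, then in
every Grundy coloring of `G`, no vertex of `W` gets a color higher than `Γ(G[W]) + s`. -/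
theorem stmt_4 {V : Type*} [Fintype V] (G : SimpleGraph V) (W : Set V) (s : ℕ)
    (hs : 1 ≤ s)
    (hdeg : ∀ x, x ∉ W → (∃ w ∈ W, G.Adj x w) → (G.neighborSet x).ncard ≤ s)
    (k : ℕ) (c : V → ℕ) (hc : IsGrundyColoring G k c) :
    ∀ w ∈ W, c w ≤ grundyNumber (G.induce W) + s := by
  intro w hw
  rcases le_or_gt (c w) s with hle | hlt
  · omega
  have hH : IsGrundyOn (G.induce W) {v | s < c v} (fun v => c v - s) := by
    refine ⟨fun v (hv : s < c v) => by omega, fun u (hu : s < c u) v (hv : s < c v) hadj => ?_,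
      fun v (hv : s < c v) j hj hjv => ?_⟩
    · have := hc.2.2.1 (SimpleGraph.induce_adj.mp hadj)
      omega
    · obtain ⟨u, hadj, hu⟩ := hc.2.2.2 v (j + s) (by omega) (by omega)
      have huW : u ∈ W := by
        by_contra huW
        have := hc.le_of_ncard_neighborSet_le (hdeg u huW ⟨v, v.2, hadj⟩) hadj hv
        omega
      refine ⟨⟨u, huW⟩, ?_, hadj, ?_⟩
      · show s < c u
        omega
      · show c u - s = j
        omega
  have : c w - s ≤ grundyNumber (G.induce W) := hH.le_grundyNumber (w := ⟨w, hw⟩) hlt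
  omega
end

section
/- Let G be a graph, let s, t be non-negative integers, and let v be a vertex of G that has at most t neighbors whose degree in G is greater than s (all its other neighbors have degree at most s). Then in every Grundy coloring of G, the vertex v receives a color at most s + t + 1. -/
/-- In a Grundy coloring, a vertex with a neighbor of larger color has degree at least its color. -/
theorem IsGrundyColoring.le_ncard_neighborSet {V : Type*} [Finite V] {G : SimpleGraph V} {k : ℕ}
    {c : V → ℕ} (hc : IsGrundyColoring G k c) {u v : V} (huv : G.Adj u v) (hlt : c u < c v) :
    c u ≤ (G.neighborSet u).ncard := by
  obtain ⟨hpos, -, -, hg⟩ := hc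
  have hsub : ((insert (c v) (Finset.Ico 1 (c u)) : Finset ℕ) : Set ℕ) ⊆ c '' G.neighborSet u := by
    intro j hj
    rcases Finset.mem_insert.1 (Finset.mem_coe.1 hj) with rfl | hj
    · exact ⟨v, huv, rfl⟩
    · obtain ⟨hj1, hj2⟩ := Finset.mem_Ico.1 hj
      obtain ⟨w, hw, hwj⟩ := hg u j hj1 hj2
      exact ⟨w, hw.symm, hwj⟩
  have hcard := (Set.ncard_le_ncard hsub (Set.toFinite _)).trans
    (Set.ncard_image_le (Set.toFinite _))
  have hv : c v ∉ Finset.Ico 1 (c u) := fun hmem => by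
    have := (Finset.mem_Ico.1 hmem).2
    omega
  rw [Set.ncard_coe_finset, Finset.card_insert_of_notMem hv, Nat.card_Ico] at hcard
  have := (hpos u).1
  omega

/-- A vertex with at most `t` neighbors of degree greater than `s` receives color at most
`s + t + 1` in any Grundy coloring. -/
theorem stmt_5 {V : Type*} [Fintype V] (G : SimpleGraph V) (s t : ℕ) (v : V)
    (h : {u | G.Adj v u ∧ s < (G.neighborSet u).ncard}.ncard ≤ t)
    (k : ℕ) (c : V → ℕ) (hc : IsGrundyColoring G k c) :
    c v ≤ s + t + 1 := by
  have hsub : (Finset.Ico (s + 1) (c v) : Set ℕ) ⊆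
      c '' {u | G.Adj v u ∧ s < (G.neighborSet u).ncard} := by
    intro j hj
    obtain ⟨hj1, hj2⟩ := Finset.mem_Ico.1 (Finset.mem_coe.1 hj)
    obtain ⟨u, huv, rfl⟩ := hc.2.2.2 v j (by omega) hj2
    exact ⟨u, ⟨huv.symm, lt_of_lt_of_le hj1 (hc.le_ncard_neighborSet huv hj2)⟩, rfl⟩
  have hcard := (Set.ncard_le_ncard hsub (Set.toFinite _)).trans
    (Set.ncard_image_le (Set.toFinite _))
  rw [Set.ncard_coe_finset, Nat.card_Ico] at hcard
  omega
end

section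
/- Let G be a graph and k a positive integer. If there exists a vertex subset S ⊆ V(G) such that G[S] admits a b-coloring of order k, then there exists a vertex subset S' ⊆ V(G) with |S'| ≤ k² such that G[S'] admits a b-coloring of order k. (Every minimal k-witness for b-Chromatic Core has at most k² vertices, since each of the k color classes needs only one center together with at most k − 1 supporting vertices.) -/
/-- A b-coloring of order `k`: a proper coloring with colors `1, …, k`, all color classes
nonempty, such that each color `i ∈ {1, …, k}` has a vertex colored `i` with a neighbor of
every other color `j ∈ {1, …, k} \ {i}`. -/
def IsBColoring {V : Type*} (G : SimpleGraph V) (k : ℕ) (c : V → ℕ) : Prop :=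
  (∀ v, 1 ≤ c v ∧ c v ≤ k) ∧
  (∀ i, 1 ≤ i → i ≤ k → ∃ v, c v = i) ∧
  (∀ ⦃u v⦄, G.Adj u v → c u ≠ c v) ∧
  (∀ i, 1 ≤ i → i ≤ k →
    ∃ v, c v = i ∧ ∀ j, 1 ≤ j → j ≤ k → j ≠ i → ∃ u, G.Adj u v ∧ c u = j)

/-- In a b-coloring, one can pick centers `w i i` together with supporting vertices `w i j`
of color `j` adjacent to them. -/
theorem IsBColoring.exists_centers {V : Type*} {G : SimpleGraph V} {k : ℕ} {c : V → ℕ}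
    (h : IsBColoring G k c) (hk : 1 ≤ k) :
    ∃ w : ℕ → ℕ → V, ∀ i ∈ Finset.Icc 1 k, ∀ j ∈ Finset.Icc 1 k,
      c (w i j) = j ∧ (j ≠ i → G.Adj (w i j) (w i i)) := by
  obtain ⟨-, hne, -, hcen⟩ := h
  obtain ⟨v₀, -⟩ := hne 1 le_rfl hk
  have key : ∀ i, ∃ f : ℕ → V, i ∈ Finset.Icc 1 k → ∀ j ∈ Finset.Icc 1 k,
      c (f j) = j ∧ (j ≠ i → G.Adj (f j) (f i)) := by
    intro i
    by_cases hi : i ∈ Finset.Icc 1 k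
    · obtain ⟨hi1, hik⟩ := Finset.mem_Icc.mp hi
      obtain ⟨b, hb, hnb⟩ := hcen i hi1 hik
      have : ∀ j, ∃ u, j ∈ Finset.Icc 1 k → j ≠ i → G.Adj u b ∧ c u = j := by
        intro j
        by_cases hj : j ∈ Finset.Icc 1 k ∧ j ≠ i
        · obtain ⟨u, hu⟩ := hnb j (Finset.mem_Icc.mp hj.1).1 (Finset.mem_Icc.mp hj.1).2 hj.2
          exact ⟨u, fun _ _ => hu⟩
        · exact ⟨v₀, fun h₁ h₂ => absurd ⟨h₁, h₂⟩ hj⟩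
      choose g hg using this
      refine ⟨Function.update g i b, fun _ j hj => ?_⟩
      by_cases hji : j = i
      · subst hji
        simp [hb]
      · simpa [hji] using (hg j hj hji).symm
    · exact ⟨fun _ => v₀, fun h => absurd h hi⟩
  choose w hw using key
  exact ⟨w, hw⟩

/-- If some induced subgraph of `G` admits a b-coloring of order `k`, then some induced
subgraph on at most `k²` vertices admits a b-coloring of order `k`. -/
theorem stmt_7 {V : Type*} [Fintype V] (G : SimpleGraph V) (k : ℕ) (hk : 1 ≤ k)
    (h : ∃ (S : Set V) (c : S → ℕ), IsBColoring (G.induce S) k c) :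
    ∃ (S' : Set V) (c' : S' → ℕ),
      S'.ncard ≤ k ^ 2 ∧ IsBColoring (G.induce S') k c' := by
  classical
  obtain ⟨S, c, hc⟩ := h
  obtain ⟨w, hw⟩ := hc.exists_centers hk
  obtain ⟨hrange, -, hproper, -⟩ := hc
  let T : Finset V := (Finset.Icc 1 k ×ˢ Finset.Icc 1 k).image fun p => (w p.1 p.2 : V)
  have hTS : ∀ v : (T : Set V), (v : V) ∈ S := by
    rintro ⟨v, hv⟩
    obtain ⟨p, -, rfl⟩ := Finset.mem_image.mp (Finset.mem_coe.mp hv)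
    exact (w p.1 p.2).2
  have hwT : ∀ i ∈ Finset.Icc 1 k, ∀ j ∈ Finset.Icc 1 k, (w i j : V) ∈ (T : Set V) :=
    fun i hi j hj => Finset.mem_coe.mpr
      (Finset.mem_image.mpr ⟨(i, j), Finset.mem_product.mpr ⟨hi, hj⟩, rfl⟩)
  refine ⟨T, fun v => c ⟨v, hTS v⟩, ?_, fun v => hrange _, fun i hi hik => ?_,
    fun u v huv => hproper (u := ⟨u, hTS u⟩) (v := ⟨v, hTS v⟩) huv, fun i hi hik => ?_⟩
  · rw [Set.ncard_coe_finset]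
    refine Finset.card_image_le.trans ?_
    simp [sq]
  · have hi' := Finset.mem_Icc.mpr ⟨hi, hik⟩
    exact ⟨⟨w i i, hwT i hi' i hi'⟩, (hw i hi' i hi').1⟩
  · have hi' := Finset.mem_Icc.mpr ⟨hi, hik⟩
    refine ⟨⟨w i i, hwT i hi' i hi'⟩, (hw i hi' i hi').1, fun j hj hjk hji => ?_⟩
    have hj' := Finset.mem_Icc.mpr ⟨hj, hjk⟩
    exact ⟨⟨w i j, hwT i hi' j hj'⟩, (hw i hi' j hj').2 hji, (hw i hi' j hj').1⟩
end

section
/- Every half-graph has Grundy number at most 3. That is, if the vertex set of a graph G can be partitioned into two independent sets A and B such that the bipartite graph formed by the edges between A and B contains no induced 2K_2, then Γ(G) ≤ 3. -/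
/-- In a Grundy coloring of a half-graph, a color greater than `1` appears on at most one side
of the bipartition. -/
lemma IsGrundyColoring.ne_of_halfGraph {V : Type*} {G : SimpleGraph V} {A B : Set V}
    (hcover : A ∪ B = Set.univ)
    (hA : ∀ u ∈ A, ∀ v ∈ A, ¬ G.Adj u v)
    (hB : ∀ u ∈ B, ∀ v ∈ B, ¬ G.Adj u v)
    (hhalf : ∀ a ∈ A, ∀ a' ∈ A, ∀ b ∈ B, ∀ b' ∈ B,
      G.Adj a b → G.Adj a' b' → G.Adj a b' ∨ G.Adj a' b)
    {k : ℕ} {c : V → ℕ} (hc : IsGrundyColoring G k c) {a b : V} (ha : a ∈ A) (hb : b ∈ B)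
    (ha1 : 1 < c a) (hb1 : 1 < c b) : c a ≠ c b := by
  obtain ⟨-, -, hproper, hgrundy⟩ := hc
  have hmem (v : V) : v ∈ A ∨ v ∈ B := (Set.mem_union v A B).1 (hcover ▸ Set.mem_univ v)
  obtain ⟨y, hya, hy⟩ := hgrundy a 1 le_rfl ha1
  obtain ⟨x, hxb, hx⟩ := hgrundy b 1 le_rfl hb1
  have hyB : y ∈ B := (hmem y).resolve_left fun h => hA y h a ha hya
  have hxA : x ∈ A := (hmem x).resolve_right fun h => hB x h b hb hxb
  rcases hhalf x hxA a ha b hb y hyB hxb hya.symm with h | h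
  · exact absurd (hx.trans hy.symm) (hproper h)
  · exact hproper h

/-- Every half-graph has Grundy number at most 3: if `V(G)` is partitioned into two
independent sets `A`, `B` whose cross edges contain no induced `2K₂`, then any Grundy
coloring of `G` has order at most 3. -/
theorem stmt_8 {V : Type*} (G : SimpleGraph V) (A B : Set V)
    (hdisj : Disjoint A B) (hcover : A ∪ B = Set.univ)
    (hA : ∀ u ∈ A, ∀ v ∈ A, ¬ G.Adj u v)
    (hB : ∀ u ∈ B, ∀ v ∈ B, ¬ G.Adj u v)
    (hhalf : ∀ a ∈ A, ∀ a' ∈ A, ∀ b ∈ B, ∀ b' ∈ B,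
      G.Adj a b → G.Adj a' b' → G.Adj a b' ∨ G.Adj a' b)
    (k : ℕ) (c : V → ℕ) (hc : IsGrundyColoring G k c) : k ≤ 3 := by
  by_contra! hk
  have hmem (v : V) : v ∈ A ∨ v ∈ B := (Set.mem_union v A B).1 (hcover ▸ Set.mem_univ v)
  have hne {a b : V} (ha : a ∈ A) (hb : b ∈ B) (ha2 : c a = 2) (hb2 : c b = 2) : False :=
    hc.ne_of_halfGraph hcover hA hB hhalf ha hb (by omega) (by omega) (ha2.trans hb2.symm)
  obtain ⟨-, hsurj, -, hgrundy⟩ := hc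
  obtain ⟨v, hv⟩ := hsurj 4 (by norm_num) hk
  obtain ⟨x, hxv, hx⟩ := hgrundy v 2 (by norm_num) (by omega)
  obtain ⟨y, hyv, hy⟩ := hgrundy v 3 (by norm_num) (by omega)
  obtain ⟨z, hzy, hz⟩ := hgrundy y 2 (by norm_num) (by omega)
  have toB {u w : V} (h : G.Adj u w) (hw : w ∈ A) : u ∈ B :=
    (hmem u).resolve_left fun hu => hA u hu w hw h
  have toA {u w : V} (h : G.Adj u w) (hw : w ∈ B) : u ∈ A :=
    (hmem u).resolve_right fun hu => hB u hu w hw h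
  rcases hmem v with h | h
  · exact hne (toA hzy (toB hyv h)) (toB hxv h) hz hx
  · exact hne (toA hxv h) (toB hzy (toA hyv h)) hx hz
end

section
/- The Grundy number of any length-two path of half-graphs is at most 5. That is, if the vertex set of a graph H is partitioned into three independent sets A, B, C such that there is no edge between A and C, and both H[A ∪ B] (with bipartition (A, B)) and H[B ∪ C] (with bipartition (B, C)) are half-graphs, then Γ(H) ≤ 5. -/
/-- The vertex set of `G` consists of three parts `X`, `Y`, `Z`, with `X` and `Z` independent and
not adjacent to each other and `Y` independent, so that edges run only between `X` and `Y` or `Y`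
and `Z`; and both of these bipartite graphs have no induced `2K₂`. -/
structure IsHalfGraphPath {V : Type*} (G : SimpleGraph V) (X Y Z : Set V) : Prop where
  left_adj : ∀ {u v}, u ∈ X → G.Adj u v → v ∈ Y
  right_adj : ∀ {u v}, u ∈ Z → G.Adj u v → v ∈ Y
  middle_adj : ∀ {u v}, u ∈ Y → G.Adj u v → v ∈ X ∨ v ∈ Z
  cross_left : ∀ {x x' y y'}, x ∈ X → x' ∈ X → y ∈ Y → y' ∈ Y →
    G.Adj x y → G.Adj x' y' → G.Adj x y' ∨ G.Adj x' y
  cross_right : ∀ {z z' y y'}, z ∈ Z → z' ∈ Z → y ∈ Y → y' ∈ Y →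
    G.Adj z y → G.Adj z' y' → G.Adj z y' ∨ G.Adj z' y

namespace IsHalfGraphPath

variable {V : Type*} {G : SimpleGraph V} {X Y Z : Set V} {k : ℕ} {c : V → ℕ}

theorem symm (h : IsHalfGraphPath G X Y Z) : IsHalfGraphPath G Z Y X :=
  ⟨h.right_adj, h.left_adj, fun hu huv => (h.middle_adj hu huv).symm, h.cross_right, h.cross_left⟩

/-- If a color occurs in the left part, then a middle vertex of that color has its neighbors of
smaller colors in the right part. -/
theorem exists_right_neighbor (h : IsHalfGraphPath G X Y Z) (hc : IsGrundyColoring G k c)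
    {x y : V} (hx : x ∈ X) (hy : y ∈ Y) (hxy : c x = c y) {i : ℕ} (hi : 1 ≤ i) (hij : i < c y) :
    ∃ z ∈ Z, G.Adj z y ∧ c z = i := by
  obtain ⟨-, -, hproper, hgrundy⟩ := hc
  obtain ⟨u, huy, hu⟩ := hgrundy y i hi hij
  obtain ⟨w, hwx, hw⟩ := hgrundy x i hi (by omega)
  rcases h.middle_adj hy huy.symm with huX | huZ
  · rcases h.cross_left hx huX (h.left_adj hx hwx.symm) hy hwx.symm huy with hadj | hadj
    · exact absurd hxy (hproper hadj)
    · exact absurd (hu.trans hw.symm) (hproper hadj)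
  · exact ⟨u, huZ, huy, hu⟩

/-- A color greater than `1` does not occur in all three parts. -/
theorem not_color_mem_all (h : IsHalfGraphPath G X Y Z) (hc : IsGrundyColoring G k c)
    {x y z : V} (hx : x ∈ X) (hy : y ∈ Y) (hz : z ∈ Z) (hxy : c x = c y) (hzy : c z = c y)
    (hy2 : 2 ≤ c y) : False := by
  obtain ⟨u, huZ, huy, hu⟩ := h.exists_right_neighbor hc hx hy hxy le_rfl (by omega)
  obtain ⟨w, hwz, hw⟩ := hc.2.2.2 z 1 le_rfl (by omega)
  rcases h.cross_right hz huZ (h.right_adj hz hwz.symm) hy hwz.symm huy with hadj | hadj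
  · exact hc.2.2.1 hadj hzy
  · exact hc.2.2.1 hadj (hu.trans hw.symm)

/-- A color greater than `3` does not occur in both the left and the middle part. -/
theorem not_color_mem_left_middle (h : IsHalfGraphPath G X Y Z) (hc : IsGrundyColoring G k c)
    {x y : V} (hx : x ∈ X) (hy : y ∈ Y) (hxy : c x = c y) (hy4 : 4 ≤ c y) : False := by
  obtain ⟨z₃, hz₃, -, hcz₃⟩ := h.exists_right_neighbor hc hx hy hxy (i := 3) (by omega) (by omega)
  obtain ⟨z₂, hz₂, -, hcz₂⟩ := h.exists_right_neighbor hc hx hy hxy (i := 2) (by omega) (by omega)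
  obtain ⟨y₃, hy₃, hcy₃⟩ := hc.2.2.2 x 3 (by omega) (by omega)
  obtain ⟨y₂, hy₂, hcy₂⟩ := hc.2.2.2 x 2 (by omega) (by omega)
  obtain ⟨x₂, hx₂, -, hcx₂⟩ := h.symm.exists_right_neighbor hc hz₃ (h.left_adj hx hy₃.symm)
    (hcz₃.trans hcy₃.symm) (i := 2) (by omega) (by omega)
  exact h.not_color_mem_all hc hx₂ (h.left_adj hx hy₂.symm) hz₂ (hcx₂.trans hcy₂.symm)
    (hcz₂.trans hcy₂.symm) (by omega)

/-- Colors greater than `3` occur either only in the middle part or only outside of it. -/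
theorem not_color_mem_outer_middle (h : IsHalfGraphPath G X Y Z) (hc : IsGrundyColoring G k c)
    {x y : V} (hx : x ∈ X ∨ x ∈ Z) (hy : y ∈ Y) (hxy : c x = c y) (hy4 : 4 ≤ c y) : False :=
  hx.elim (fun hx => h.not_color_mem_left_middle hc hx hy hxy hy4)
    (fun hx => h.symm.not_color_mem_left_middle hc hx hy hxy hy4)

theorem outer_adj (h : IsHalfGraphPath G X Y Z) {u v : V} (hu : u ∈ X ∨ u ∈ Z)
    (huv : G.Adj u v) : v ∈ Y :=
  hu.elim (fun hu => h.left_adj hu huv) (fun hu => h.right_adj hu huv)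

/-- A vertex of color greater than `5` would see colors `4` and `5` on the same side, while a
vertex of color `5` sees color `4` on the other side. -/
theorem color_le_five (h : IsHalfGraphPath G X Y Z) (hc : IsGrundyColoring G k c) {v : V}
    (hv : v ∈ Y ∨ v ∈ X ∨ v ∈ Z) : c v ≤ 5 := by
  by_contra! hlt
  obtain ⟨p, hpv, hp⟩ := hc.2.2.2 v 5 (by omega) (by omega)
  obtain ⟨q, hqv, hq⟩ := hc.2.2.2 v 4 (by omega) (by omega)
  obtain ⟨r, hrp, hr⟩ := hc.2.2.2 p 4 (by omega) (by omega)
  rcases hv with hv | hv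
  · exact h.not_color_mem_outer_middle hc (h.middle_adj hv hqv.symm)
      (h.outer_adj (h.middle_adj hv hpv.symm) hrp.symm) (hq.trans hr.symm) (by omega)
  · exact h.not_color_mem_outer_middle hc (h.middle_adj (h.outer_adj hv hpv.symm) hrp.symm)
      (h.outer_adj hv hqv.symm) (hr.trans hq.symm) (by omega)

end IsHalfGraphPath

/-- The Grundy number of a length-two path of half-graphs is at most 5: if `V(H)` is
partitioned into independent sets `A`, `B`, `C` with no edge between `A` and `C`, and both
`(A, B)` and `(B, C)` induce half-graphs (no cross induced `2K₂`), then any Grundy coloring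
of `H` has order at most 5. -/
theorem stmt_9 {V : Type*} (H : SimpleGraph V) (A B C : Set V)
    (hAB : Disjoint A B) (hAC : Disjoint A C) (hBC : Disjoint B C)
    (hcover : A ∪ B ∪ C = Set.univ)
    (hA : ∀ u ∈ A, ∀ v ∈ A, ¬ H.Adj u v)
    (hB : ∀ u ∈ B, ∀ v ∈ B, ¬ H.Adj u v)
    (hC : ∀ u ∈ C, ∀ v ∈ C, ¬ H.Adj u v)
    (hACedge : ∀ u ∈ A, ∀ v ∈ C, ¬ H.Adj u v)
    (hhalfAB : ∀ a ∈ A, ∀ a' ∈ A, ∀ b ∈ B, ∀ b' ∈ B,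
      H.Adj a b → H.Adj a' b' → H.Adj a b' ∨ H.Adj a' b)
    (hhalfBC : ∀ b ∈ B, ∀ b' ∈ B, ∀ d ∈ C, ∀ d' ∈ C,
      H.Adj b d → H.Adj b' d' → H.Adj b d' ∨ H.Adj b' d)
    (k : ℕ) (c : V → ℕ) (hc : IsGrundyColoring H k c) : k ≤ 5 := by
  have hmem : ∀ v, v ∈ A ∨ v ∈ B ∨ v ∈ C := fun v => by
    simpa [or_assoc] using hcover.ge (Set.mem_univ v)
  have h : IsHalfGraphPath H A B C :=
    { left_adj := fun {u v} hu huv => by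
        rcases hmem v with hv | hv | hv
        exacts [(hA u hu v hv huv).elim, hv, (hACedge u hu v hv huv).elim]
      right_adj := fun {u v} hu huv => by
        rcases hmem v with hv | hv | hv
        exacts [(hACedge v hv u hu huv.symm).elim, hv, (hC u hu v hv huv).elim]
      middle_adj := fun {u v} hu huv => by
        rcases hmem v with hv | hv | hv
        exacts [Or.inl hv, (hB u hu v hv huv).elim, Or.inr hv]
      cross_left := fun {x x' y y'} hx hx' hy hy' => hhalfAB x hx x' hx' y hy y' hy'
      cross_right := fun {z z' y y'} hz hz' hy hy' hzy hzy' =>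
        (hhalfBC y hy y' hy' z hz z' hz' hzy.symm hzy'.symm).symm.imp
          (fun e => e.symm) (fun e => e.symm) }
  rcases Nat.eq_zero_or_pos k with rfl | hk
  · exact Nat.zero_le 5
  · obtain ⟨v, hv⟩ := hc.2.1 k hk le_rfl
    rw [← hv]
    exact h.color_le_five hc (or_left_comm.mp (hmem v))
end

section
/- For every non-negative integer ℓ, the Grundy number of any length-ℓ path of half-graphs is at most 4^ℓ. That is, if the vertex set of a graph G is partitioned into independent sets V_0, V_1, …, V_ℓ such that there is no edge between V_i and V_j whenever |i − j| ≥ 2, and for every i the induced subgraph G[V_i ∪ V_{i+1}] is a half-graph with bipartition (V_i, V_{i+1}), then Γ(G) ≤ 4^ℓ. -/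
/-- Let `p` assign layers to the vertices so that edges join consecutive layers and any two
consecutive layers induce a half-graph. If a proper coloring satisfies the Grundy condition for the
colors of `S` on the layers `m, …, m + n`, then `S` has fewer than `2 ^ (n + 1)` colors. -/
theorem card_lt_two_pow_of_grundy_layers {V : Type*} (G : SimpleGraph V) (p c : V → ℕ)
    (hadj : ∀ u v, G.Adj u v → p u = p v + 1 ∨ p v = p u + 1)
    (hhalf : ∀ a a' b b', p a' = p a → p b = p a + 1 → p b' = p a + 1 →
      G.Adj a b → G.Adj a' b' → G.Adj a b' ∨ G.Adj a' b)
    (hproper : ∀ u v, G.Adj u v → c u ≠ c v) (n : ℕ) :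
    ∀ (m : ℕ) (S : Finset ℕ), (∀ v, p v ≤ m + n) →
      (∀ s ∈ S, ∃ v, m ≤ p v ∧ c v = s) →
      (∀ v, m ≤ p v → c v ∈ S → ∀ j ∈ S, j < c v → ∃ u, m ≤ p u ∧ G.Adj u v ∧ c u = j) →
      S.card < 2 ^ (n + 1) := by
  classical
  induction n with
  | zero =>
    intro m S hle hex hgr
    have h_one : S.card ≤ 1 := by
      by_contra! h
      obtain ⟨i, hi, j, hj, hij⟩ := Finset.one_lt_card.1 h
      wlog hlt : i < j generalizing i j
      · exact this j hj i hi hij.symm (by omega)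
      obtain ⟨v, hv, rfl⟩ := hex j hj
      obtain ⟨u, hu, huv, -⟩ := hgr v hv hj i hi hlt
      have := hadj u v huv
      have := hle u
      have := hle v
      omega
    simpa using Nat.lt_succ_of_le h_one
  | succ n ih =>
    intro m S hle hex hgr
    have hle' : ∀ v, p v ≤ m + 1 + n := fun v => by have := hle v; omega
    set S₀ := S.filter (fun s => ∃ v, p v = m ∧ c v = s) with hS₀
    set S₁ := S.filter (fun s => ¬ ∃ v, p v = m ∧ c v = s) with hS₁
    have hcard : S₀.card + S₁.card = S.card := Finset.card_filter_add_card_filter_not _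
    have h₁ : S₁.card < 2 ^ (n + 1) := by
      refine ih (m + 1) S₁ hle' ?_ ?_
      · intro s hs
        obtain ⟨hsS, hs⟩ := Finset.mem_filter.1 hs
        obtain ⟨v, hv, hcv⟩ := hex s hsS
        exact ⟨v, lt_of_le_of_ne hv fun h => hs ⟨v, h.symm, hcv⟩, hcv⟩
      · intro v hv hcv j hj hlt
        obtain ⟨hjS, hj⟩ := Finset.mem_filter.1 hj
        obtain ⟨u, hu, huv, hcu⟩ := hgr v (by omega) (Finset.mem_filter.1 hcv).1 j hjS hlt
        exact ⟨u, lt_of_le_of_ne hu fun h => hj ⟨u, h.symm, hcu⟩, huv, hcu⟩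
    have h₀ : (S₀.erase (S₀.sup id)).card < 2 ^ (n + 1) := by
      refine ih (m + 1) _ hle' ?_ ?_
      · intro s hs
        obtain ⟨hne, hs⟩ := Finset.mem_erase.1 hs
        have hlt : s < S₀.sup id := lt_of_le_of_ne (Finset.le_sup (f := id) hs) hne
        obtain ⟨t, ht, htsup⟩ := Finset.exists_mem_eq_sup S₀ ⟨s, hs⟩ id
        rw [htsup] at hlt
        obtain ⟨htS, a, ha, hca⟩ := Finset.mem_filter.1 ht
        subst hca
        obtain ⟨u, hu, hua, hcu⟩ := hgr a ha.ge htS s (Finset.mem_filter.1 hs).1 hlt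
        refine ⟨u, ?_, hcu⟩
        have := hadj u a hua
        omega
      · intro v hv hcv j hj hlt
        obtain ⟨hvS, a, ha, hca⟩ := Finset.mem_filter.1 (Finset.mem_of_mem_erase hcv)
        obtain ⟨hjS, -⟩ := Finset.mem_filter.1 (Finset.mem_of_mem_erase hj)
        obtain ⟨u, hu, huv, hcu⟩ := hgr v (by omega) hvS j hjS hlt
        refine ⟨u, lt_of_le_of_ne hu fun hum => ?_, huv, hcu⟩
        -- `a` and `u` lie in layer `m`, and the half-graph property creates a monochromatic edge
        obtain ⟨w, hw, hwa, hcw⟩ := hgr a ha.ge (hca ▸ hvS) j hjS (hca ▸ hlt)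
        have hpv := hadj u v huv
        have hpw := hadj w a hwa
        rcases hhalf a u w v (by omega) (by omega) (by omega) hwa.symm huv with h | h
        · exact hproper _ _ h hca
        · exact hproper _ _ h (hcu.trans hcw.symm)
    have herase : S₀.card - 1 ≤ (S₀.erase (S₀.sup id)).card := Finset.pred_card_le_card_erase
    rw [pow_succ]
    omega

/-- The Grundy number of a length-`ℓ` path of half-graphs is at most `4 ^ ℓ`: if `V(G)` is
partitioned into independent sets `P 0, …, P ℓ` with no edge between `P i` and `P j` when
`|i − j| ≥ 2`, and each consecutive pair `(P i, P (i+1))` induces a half-graph (no cross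
induced `2K₂`), then any Grundy coloring of `G` has order at most `4 ^ ℓ`. -/
theorem stmt_10 {V : Type*} (G : SimpleGraph V) (ℓ : ℕ) (P : Fin (ℓ + 1) → Set V)
    (hdisj : ∀ i j, i ≠ j → Disjoint (P i) (P j))
    (hcover : (⋃ i, P i) = Set.univ)
    (hindep : ∀ i, ∀ u ∈ P i, ∀ v ∈ P i, ¬ G.Adj u v)
    (hfar : ∀ i j : Fin (ℓ + 1), (i : ℕ) + 2 ≤ (j : ℕ) →
      ∀ u ∈ P i, ∀ v ∈ P j, ¬ G.Adj u v)
    (hhalf : ∀ i : Fin ℓ, ∀ a ∈ P i.castSucc, ∀ a' ∈ P i.castSucc,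
      ∀ b ∈ P i.succ, ∀ b' ∈ P i.succ,
      G.Adj a b → G.Adj a' b' → G.Adj a b' ∨ G.Adj a' b)
    (k : ℕ) (c : V → ℕ) (hc : IsGrundyColoring G k c) : k ≤ 4 ^ ℓ := by
  obtain ⟨-, hex, hproper, hgr⟩ := hc
  have hmem : ∀ v, ∃ i, v ∈ P i := fun v => Set.mem_iUnion.1 (hcover ▸ Set.mem_univ v)
  choose q hq using hmem
  have hadj : ∀ u v, G.Adj u v → (q u : ℕ) = q v + 1 ∨ (q v : ℕ) = q u + 1 := by
    intro u v huv
    have hne : (q u : ℕ) ≠ q v := fun h =>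
      hindep (q v) u (Fin.ext h ▸ hq u) v (hq v) huv
    have huv_far : ¬ (q u : ℕ) + 2 ≤ q v := fun h => hfar _ _ h u (hq u) v (hq v) huv
    have hvu_far : ¬ (q v : ℕ) + 2 ≤ q u := fun h => hfar _ _ h v (hq v) u (hq u) huv.symm
    omega
  have hlayers : ∀ a a' b b', (q a' : ℕ) = q a → (q b : ℕ) = q a + 1 → (q b' : ℕ) = q a + 1 →
      G.Adj a b → G.Adj a' b' → G.Adj a b' ∨ G.Adj a' b := by
    intro a a' b b' ha' hb hb'
    have hlt : (q a : ℕ) < ℓ := by have := (q b).isLt; omega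
    have hmem_of_eq : ∀ v (i : Fin (ℓ + 1)), (q v : ℕ) = i → v ∈ P i :=
      fun v i h => Fin.ext h ▸ hq v
    exact hhalf ⟨q a, hlt⟩ a (hmem_of_eq _ _ rfl) a' (hmem_of_eq _ _ ha')
      b (hmem_of_eq _ _ hb) b' (hmem_of_eq _ _ hb')
  have hlt := card_lt_two_pow_of_grundy_layers G (fun v => (q v : ℕ)) c hadj hlayers
    (fun u v h => hproper h) ℓ 0 (Finset.Icc 1 k) (fun v => by have := (q v).isLt; omega)
    (fun s hs => by
      obtain ⟨h_one, hk⟩ := Finset.mem_Icc.1 hs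
      obtain ⟨v, hv⟩ := hex s h_one hk
      exact ⟨v, Nat.zero_le _, hv⟩)
    (fun v _ _ j hj hjv => by
      obtain ⟨u, huv, hu⟩ := hgr v j (Finset.mem_Icc.1 hj).1 hjv
      exact ⟨u, Nat.zero_le _, huv, hu⟩)
  rw [Nat.card_Icc, Nat.add_sub_cancel] at hlt
  have hpow : 2 ^ (ℓ + 1) ≤ 4 ^ ℓ + 1 := by
    rcases ℓ with _ | ℓ
    · simp
    · calc 2 ^ (ℓ + 1 + 1) ≤ 2 ^ (2 * (ℓ + 1)) := Nat.pow_le_pow_right (by norm_num) (by omega)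
        _ = 4 ^ (ℓ + 1) := by rw [pow_mul]; norm_num
        _ ≤ 4 ^ (ℓ + 1) + 1 := Nat.le_succ _
  omega
end

section
/- The Grundy number of any length-four path of half-graphs is at most 53. That is, if the vertex set of a graph G is partitioned into independent sets V_0, V_1, V_2, V_3, V_4 such that there is no edge between V_i and V_j whenever |i − j| ≥ 2, and for every i ∈ {0, 1, 2, 3} the induced subgraph G[V_i ∪ V_{i+1}] is a half-graph with bipartition (V_i, V_{i+1}), then Γ(G) ≤ 53. -/
/-- A layering `f` of `G` by integers in which edges join consecutive layers and consecutive
layers induce half-graphs, with a proper coloring `c` in which every vertex sees every smaller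
color exceeding `s`. -/
structure IsGrundyLayering {V : Type*} (G : SimpleGraph V) (c : V → ℕ) (s : ℕ) (f : V → ℤ) :
    Prop where
  proper : ∀ ⦃u v⦄, G.Adj u v → c u ≠ c v
  layer : ∀ ⦃u v⦄, G.Adj u v → f v = f u + 1 ∨ f v = f u - 1
  half : ∀ ⦃a b a' b'⦄, G.Adj a b → G.Adj a' b' → f a = f a' → f b = f b' →
    G.Adj a b' ∨ G.Adj a' b
  sees : ∀ v j, s < j → j < c v → ∃ u, G.Adj u v ∧ c u = j

namespace IsGrundyLayering

variable {V : Type*} {G : SimpleGraph V} {c : V → ℕ} {s : ℕ} {f : V → ℤ}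

theorem neg (h : IsGrundyLayering G c s f) : IsGrundyLayering G c s (fun v => -f v) where
  proper := h.proper
  layer u v huv := by have := h.layer huv; omega
  half a b a' b' hab hab' ha hb := h.half hab hab' (by omega) (by omega)
  sees := h.sees

theorem mono (h : IsGrundyLayering G c s f) {t : ℕ} (hst : s ≤ t) :
    IsGrundyLayering G c t f where
  proper := h.proper
  layer := h.layer
  half := h.half
  sees v j hj := h.sees v j (by omega)

/-- Across a pair of consecutive layers, color `j` cannot see color `i` in both directions. -/
theorem not_cross (h : IsGrundyLayering G c s f) {a b a' b' : V} (hab : G.Adj a b)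
    (hab' : G.Adj a' b') (hfa : f a = f a') (hfb : f b = f b') (ha : c a = c b')
    (hb : c b = c a') : False := by
  rcases h.half hab hab' hfa hfb with h1 | h1
  · exact h.proper h1 ha
  · exact h.proper h1 hb.symm

/-- If all colors of `U` occur in layer `b`, and there each of them sees all smaller colors of `U`
in layer `b + 1`, then `U` is bounded by the number of layers from `b` on. -/
theorem card_le (h : IsGrundyLayering G c s f) (n : ℕ) (b : ℤ) (U : Finset ℕ)
    (hs : ∀ j ∈ U, s < j) (hf : ∀ v, s < c v → f v ≤ b + n)
    (hex : ∀ j ∈ U, ∃ v, f v = b ∧ c v = j)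
    (hsee : ∀ v, f v = b → c v ∈ U → ∀ i ∈ U, i < c v →
      ∃ u, G.Adj u v ∧ c u = i ∧ f u = b + 1) : U.card ≤ n + 1 := by
  induction n generalizing b U with
  | zero =>
    rw [zero_add, Finset.card_le_one]
    have key : ∀ i ∈ U, ∀ j ∈ U, ¬ i < j := by
      intro i hi j hj hij
      obtain ⟨v, hv, rfl⟩ := hex j hj
      obtain ⟨u, -, rfl, hu⟩ := hsee v hv hj i hi hij
      have := hf u (hs _ hi)
      push_cast at this
      omega
    intro i hi j hj
    have := key i hi j hj
    have := key j hj i hi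
    omega
  | succ n ih =>
    rcases U.eq_empty_or_nonempty with rfl | hU
    · simp
    have hm := U.max'_mem hU
    have hlt : ∀ j ∈ U.erase (U.max' hU), j < U.max' hU := fun j hj =>
      lt_of_le_of_ne (U.le_max' j (Finset.mem_of_mem_erase hj)) (Finset.ne_of_mem_erase hj)
    have := ih (b + 1) (U.erase (U.max' hU)) (fun j hj => hs j (Finset.mem_of_mem_erase hj))
      (fun v hv => by have := hf v hv; push_cast at this; omega)
      (fun j hj => by
        obtain ⟨v, hv, hcv⟩ := hex _ hm
        obtain ⟨u, -, hu, hfu⟩ := hsee v hv (hcv ▸ hm) j (Finset.mem_of_mem_erase hj)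
          (hcv ▸ hlt j hj)
        exact ⟨u, hfu, hu⟩)
      (fun v hv hvU i hi hiv => by
        have hvU' := Finset.mem_of_mem_erase hvU
        have hi' := Finset.mem_of_mem_erase hi
        obtain ⟨u, huv, hu⟩ := h.sees v i (hs i hi') hiv
        refine ⟨u, huv, hu, ?_⟩
        rcases h.layer huv.symm with hl | hl
        · omega
        · obtain ⟨w, hw, hcw⟩ := hex _ hvU'
          obtain ⟨x, hxw, hx, hfx⟩ := hsee w hw (hcw ▸ hvU') i hi' (hcw ▸ hiv)
          exact (h.not_cross hxw.symm huv (by omega) (by omega) hcw (by omega)).elim)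
    rw [Finset.card_erase_of_mem hm] at this
    omega

/-- The colors in the first of `n + 2` layers are at most `s + 2 * n + 3`. -/
theorem color_le (h : IsGrundyLayering G c s f) (n : ℕ) (b : ℤ)
    (hf : ∀ v, s < c v → b ≤ f v ∧ f v ≤ b + 1 + n) (v : V) (hv : f v = b) :
    c v ≤ s + 2 * n + 3 := by
  classical
  have hlow : ∀ w, f w = b → ∀ i, s < i → i < c w → ∃ u, G.Adj u w ∧ c u = i ∧ f u = b + 1 := by
    intro w hw i hsi hi
    obtain ⟨u, huw, rfl⟩ := h.sees w i hsi hi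
    refine ⟨u, huw, rfl, ?_⟩
    have := hf u hsi
    rcases h.layer huw.symm with hl | hl <;> omega
  have hex : ∀ j ∈ Finset.Ioo s (c v), ∃ w, f w = b + 1 ∧ c w = j := by
    intro j hj
    rw [Finset.mem_Ioo] at hj
    obtain ⟨u, -, hu, hfu⟩ := hlow v hv j hj.1 hj.2
    exact ⟨u, hfu, hu⟩
  have hs : ∀ j ∈ Finset.Ioo s (c v), s < j := fun j hj => (Finset.mem_Ioo.1 hj).1
  have h1 := h.card_le n (b + 1) {j ∈ Finset.Ioo s (c v) | ∃ w, f w = b ∧ c w = j}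
    (fun j hj => hs j (Finset.mem_filter.1 hj).1) (fun v hv => (hf v hv).2)
    (fun j hj => hex j (Finset.mem_filter.1 hj).1)
    (fun w hw hwU i hi hiw => by
      rw [Finset.mem_filter] at hwU hi
      obtain ⟨u, huw, hu⟩ := h.sees w i (hs i hi.1) hiw
      refine ⟨u, huw, hu, ?_⟩
      rcases h.layer huw.symm with hl | hl
      · omega
      · obtain ⟨x, hx, hcx⟩ := hwU.2
        obtain ⟨y, hyx, hy, hfy⟩ := hlow x hx i (hs i hi.1) (hcx ▸ hiw)
        exact (h.not_cross hyx.symm huw (by omega) (by omega) hcx (by omega)).elim)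
  have h2 := h.card_le n (b + 1) {j ∈ Finset.Ioo s (c v) | ¬ ∃ w, f w = b ∧ c w = j}
    (fun j hj => hs j (Finset.mem_filter.1 hj).1) (fun v hv => (hf v hv).2)
    (fun j hj => hex j (Finset.mem_filter.1 hj).1)
    (fun w hw hwU i hi hiw => by
      rw [Finset.mem_filter] at hwU hi
      obtain ⟨u, huw, hu⟩ := h.sees w i (hs i hi.1) hiw
      refine ⟨u, huw, hu, ?_⟩
      rcases h.layer huw.symm with hl | hl
      · omega
      · exact (hi.2 ⟨u, by omega, hu⟩).elim)
  have h3 := Finset.card_filter_add_card_filter_not (s := Finset.Ioo s (c v))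
    (fun j => ∃ w, f w = b ∧ c w = j)
  rw [Nat.card_Ioo] at h3
  omega

/-- Two-sided version of `color_le`: larger colors avoid both extreme layers. -/
theorem layer_lt (h : IsGrundyLayering G c s f) (n : ℕ) (b : ℤ)
    (hf : ∀ v, s < c v → b ≤ f v ∧ f v ≤ b + 1 + n) (v : V) (hv : s + 2 * n + 3 < c v) :
    b + 1 ≤ f v ∧ f v ≤ b + n := by
  have hb := hf v (by omega)
  have h1 : f v ≠ b := fun e => by
    have := h.color_le n b hf v e
    omega
  have h2 : f v ≠ b + 1 + n := fun e => by
    have := h.neg.color_le n (-(b + 1 + n)) (fun w hw => by have := hf w hw; omega) v (by omega)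
    omega
  omega

/-- With five layers there are at most fifteen colors. -/
theorem color_le_fifteen (h : IsGrundyLayering G c 0 f) (hf : ∀ v, 0 ≤ f v ∧ f v ≤ 4) (v : V) :
    c v ≤ 15 := by
  have h1 : ∀ v, 9 < c v → 1 ≤ f v ∧ f v ≤ 3 := fun v hv => by
    have := h.layer_lt 3 0 (fun v _ => by have := hf v; norm_num; omega) v (by omega)
    norm_num at this
    omega
  have h2 : ∀ v, 14 < c v → f v = 2 := fun v hv => by
    have := (h.mono (t := 9) (by omega)).layer_lt 1 1
      (fun v hv => by have := h1 v hv; norm_num; omega) v (by omega)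
    norm_num at this
    omega
  by_contra! hv
  obtain ⟨u, huv, hu⟩ := h.sees v 15 (by omega) hv
  have := h2 v (by omega)
  have := h2 u (by omega)
  have := h.layer huv
  omega

end IsGrundyLayering

/-- The Grundy number of a length-four path of half-graphs is at most 53: if `V(G)` is
partitioned into independent sets `P 0, …, P 4` with no edge between `P i` and `P j` when
`|i − j| ≥ 2`, and each consecutive pair `(P i, P (i+1))` induces a half-graph (no cross
induced `2K₂`), then any Grundy coloring of `G` has order at most 53. -/
theorem stmt_11 {V : Type*} (G : SimpleGraph V) (P : Fin 5 → Set V)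
    (hdisj : ∀ i j, i ≠ j → Disjoint (P i) (P j))
    (hcover : (⋃ i, P i) = Set.univ)
    (hindep : ∀ i, ∀ u ∈ P i, ∀ v ∈ P i, ¬ G.Adj u v)
    (hfar : ∀ i j : Fin 5, (i : ℕ) + 2 ≤ (j : ℕ) →
      ∀ u ∈ P i, ∀ v ∈ P j, ¬ G.Adj u v)
    (hhalf : ∀ i : Fin 4, ∀ a ∈ P i.castSucc, ∀ a' ∈ P i.castSucc,
      ∀ b ∈ P i.succ, ∀ b' ∈ P i.succ,
      G.Adj a b → G.Adj a' b' → G.Adj a b' ∨ G.Adj a' b)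
    (k : ℕ) (c : V → ℕ) (hc : IsGrundyColoring G k c) : k ≤ 53 := by
  have hpart : ∀ v, ∃ i, v ∈ P i := fun v => by
    have : v ∈ ⋃ i, P i := hcover ▸ Set.mem_univ v
    simpa using this
  choose p hp using hpart
  have hlayer : ∀ ⦃u v⦄, G.Adj u v →
      ((p v : ℕ) : ℤ) = (p u : ℕ) + 1 ∨ ((p v : ℕ) : ℤ) = (p u : ℕ) - 1 := by
    intro u v huv
    have h0 : (p u : ℕ) ≠ p v := fun e =>
      hindep (p v) u (Fin.ext e ▸ hp u) v (hp v) huv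
    have h1 : ¬ (p u : ℕ) + 2 ≤ p v := fun e => hfar _ _ e u (hp u) v (hp v) huv
    have h2 : ¬ (p v : ℕ) + 2 ≤ p u := fun e => hfar _ _ e v (hp v) u (hp u) huv.symm
    omega
  have hup : ∀ ⦃a b a' b'⦄, G.Adj a b → G.Adj a' b' → p a = p a' → p b = p b' →
      (p b : ℕ) = p a + 1 → G.Adj a b' ∨ G.Adj a' b := by
    intro a b a' b' hab hab' ha hb he
    have hlt : (p a : ℕ) < 4 := by omega
    have ea : p a = (⟨p a, hlt⟩ : Fin 4).castSucc := rfl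
    have eb : p b = (⟨p a, hlt⟩ : Fin 4).succ := Fin.ext he
    exact hhalf ⟨p a, hlt⟩ a (ea ▸ hp a) a' (ea ▸ ha ▸ hp a') b (eb ▸ hp b) b'
      (eb ▸ hb ▸ hp b') hab hab'
  have h : IsGrundyLayering G c 0 (fun v => ((p v : ℕ) : ℤ)) := by
    refine ⟨hc.2.2.1, hlayer, fun a b a' b' hab hab' ha hb => ?_, fun v j hj => hc.2.2.2 v j hj⟩
    have ha' : p a = p a' := Fin.ext (by exact_mod_cast ha)
    have hb' : p b = p b' := Fin.ext (by exact_mod_cast hb)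
    rcases hlayer hab with hl | hl
    · exact hup hab hab' ha' hb' (by omega)
    · rcases hup hab.symm hab'.symm hb' ha' (by omega) with h1 | h1
      · exact Or.inr h1.symm
      · exact Or.inl h1.symm
  by_contra! hk
  obtain ⟨v, hv⟩ := hc.2.1 k (by omega) le_rfl
  have := h.color_le_fifteen (fun v => by have := (p v).isLt; omega) v
  omega
end

section
/- Let G be a graph, p a non-negative integer, A ⊆ V(G) a set of vertices, and Y = ⋂_{v ∈ A} N_G(v) the common (open) neighborhood of A. Suppose that |N_G(v) \ Y| ≤ p for every v ∈ A. Then for every proper coloring of G with color set {1, …, k}, the number of distinct colors i for which A contains a vertex of color i that is adjacent to vertices of all k − 1 other colors is at most p + 1. In other words, the maximum number of b-coloring centers in A with pairwise distinct colors is at most p + 1. -/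
/-- If `Y` is the common neighborhood of a vertex set `A` and every vertex of `A` has at
most `p` neighbors outside `Y`, then in any proper coloring of `G` with colors `1, …, k`,
the number of colors realized by a b-coloring center lying in `A` is at most `p + 1`. -/
theorem stmt_13 {V : Type*} [Fintype V] (G : SimpleGraph V) (p k : ℕ) (A : Set V)
    (hp : ∀ v ∈ A, (G.neighborSet v \ ⋂ w ∈ A, G.neighborSet w).ncard ≤ p)
    (c : V → ℕ) (hcol : ∀ v, 1 ≤ c v ∧ c v ≤ k)
    (hproper : ∀ ⦃u v⦄, G.Adj u v → c u ≠ c v) :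
    {i : ℕ | ∃ v ∈ A, c v = i ∧
      ∀ j, 1 ≤ j → j ≤ k → j ≠ i → ∃ u, G.Adj v u ∧ c u = j}.ncard ≤ p + 1 := by
  set S := {i : ℕ | ∃ v ∈ A, c v = i ∧
      ∀ j, 1 ≤ j → j ≤ k → j ≠ i → ∃ u, G.Adj v u ∧ c u = j}
  rcases S.eq_empty_or_nonempty with hempty | ⟨i, v, hvA, -, hcenter⟩
  · simp [hempty]
  have hsub : S ⊆ insert i (c '' (G.neighborSet v \ ⋂ w ∈ A, G.neighborSet w)) := by
    rintro j ⟨w, hwA, hwj, -⟩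
    rcases eq_or_ne j i with rfl | hji
    · exact Set.mem_insert _ _
    obtain ⟨u, hvu, huj⟩ := hcenter j (hwj ▸ (hcol w).1) (hwj ▸ (hcol w).2) hji
    refine Set.mem_insert_of_mem _ ⟨u, ⟨hvu, fun hu => ?_⟩, huj⟩
    exact hproper (Set.mem_iInter₂.mp hu w hwA) (hwj.trans huj.symm)
  calc S.ncard
      ≤ (insert i (c '' (G.neighborSet v \ ⋂ w ∈ A, G.neighborSet w))).ncard :=
        Set.ncard_le_ncard hsub (((Set.toFinite _).image c).insert i)
    _ ≤ (c '' (G.neighborSet v \ ⋂ w ∈ A, G.neighborSet w)).ncard + 1 :=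
        Set.ncard_insert_le _ _
    _ ≤ p + 1 :=
        Nat.add_le_add_right ((Set.ncard_image_le (Set.toFinite _)).trans (hp v hvA)) 1
end

section
/- Let G be a graph, p a non-negative integer, and A, Y disjoint vertex subsets of G such that the induced subgraph G[A ∪ Y] is a half-graph with bipartition (A, Y). Suppose that |N_G(v) \ Y| ≤ p for every v ∈ A. Then for every proper coloring of G with color set {1, …, k}, the number of distinct colors i for which A contains a vertex of color i that is adjacent to vertices of all k − 1 other colors is at most p + 1. In other words, the maximum number of b-coloring centers in A with pairwise distinct colors is at most p + 1. -/
/-- If `(A, Y)` induces a half-graph in `G` (both sides independent, no cross induced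
`2K₂`) and every vertex of `A` has at most `p` neighbors outside `Y`, then in any proper
coloring of `G` with colors `1, …, k`, the number of colors realized by a b-coloring center
lying in `A` is at most `p + 1`. -/
theorem stmt_14 {V : Type*} [Fintype V] (G : SimpleGraph V) (p k : ℕ) (A Y : Set V)
    (hdisj : Disjoint A Y)
    (hA : ∀ u ∈ A, ∀ v ∈ A, ¬ G.Adj u v)
    (hY : ∀ u ∈ Y, ∀ v ∈ Y, ¬ G.Adj u v)
    (hhalf : ∀ a ∈ A, ∀ a' ∈ A, ∀ b ∈ Y, ∀ b' ∈ Y,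
      G.Adj a b → G.Adj a' b' → G.Adj a b' ∨ G.Adj a' b)
    (hp : ∀ v ∈ A, (G.neighborSet v \ Y).ncard ≤ p)
    (c : V → ℕ) (hcol : ∀ v, 1 ≤ c v ∧ c v ≤ k)
    (hproper : ∀ ⦃u v⦄, G.Adj u v → c u ≠ c v) :
    {i : ℕ | ∃ v ∈ A, c v = i ∧
      ∀ j, 1 ≤ j → j ≤ k → j ≠ i → ∃ u, G.Adj v u ∧ c u = j}.ncard ≤ p + 1 := by
  set C : Set V := {v | v ∈ A ∧ ∀ j, 1 ≤ j → j ≤ k → j ≠ c v → ∃ u, G.Adj v u ∧ c u = j}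
  have hS : {i : ℕ | ∃ v ∈ A, c v = i ∧
      ∀ j, 1 ≤ j → j ≤ k → j ≠ i → ∃ u, G.Adj v u ∧ c u = j} = c '' C := by
    ext i
    constructor
    · rintro ⟨v, hv, rfl, h⟩
      exact ⟨v, ⟨hv, h⟩, rfl⟩
    · rintro ⟨v, ⟨hv, h⟩, rfl⟩
      exact ⟨v, hv, rfl, h⟩
  rw [hS]
  rcases C.eq_empty_or_nonempty with hE | hne
  · simp [hE]
  obtain ⟨v, hv, hmin⟩ :=
    Set.exists_min_image C (fun v => (G.neighborSet v ∩ Y).ncard) C.toFinite hne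
  have hsub : ∀ w ∈ C, ∀ b ∈ Y, G.Adj v b → G.Adj w b := by
    intro w hw b hb hvb
    by_contra hwb
    refine (hmin w hw).not_gt (Set.ncard_lt_ncard ?_ (Set.toFinite _))
    refine ⟨fun b' hb' => ⟨?_, hb'.2⟩, fun h => hwb (h ⟨hvb, hb⟩).1⟩
    exact (hhalf v hv.1 w hw.1 b hb b' hb'.2 hvb hb'.1).resolve_right hwb
  have hcover : c '' C ⊆ insert (c v) (c '' (G.neighborSet v \ Y)) := by
    rintro _ ⟨w, hw, rfl⟩
    by_cases hwv : c w = c v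
    · exact Or.inl hwv
    obtain ⟨u, hvu, hu⟩ := hv.2 (c w) (hcol w).1 (hcol w).2 hwv
    exact Or.inr ⟨u, ⟨hvu, fun huY => hproper (hsub w hw u huY hvu) hu.symm⟩, hu⟩
  calc (c '' C).ncard
      ≤ (insert (c v) (c '' (G.neighborSet v \ Y))).ncard :=
        Set.ncard_le_ncard hcover (Set.toFinite _)
    _ ≤ (c '' (G.neighborSet v \ Y)).ncard + 1 := Set.ncard_insert_le _ _
    _ ≤ (G.neighborSet v \ Y).ncard + 1 :=
        Nat.add_le_add_right (Set.ncard_image_le (Set.toFinite _)) 1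
    _ ≤ p + 1 := Nat.add_le_add_right (hp v hv.1) 1
end

section
/- Let t and N be positive integers with N ≥ t, and let G be a graph on vertex set A ⊎ B that does not contain K_{t,t} as a subgraph. If |A| ≥ N·2^{N+t} and |B| ≥ N + t, then there exist subsets A' ⊆ A and B' ⊆ B, each of size at least N, such that there is no edge of G between A' and B'. -/
/-- `G` contains `K_{t,t}` as a (not necessarily induced) subgraph: there are two disjoint
sets of `t` vertices each with all cross pairs adjacent. -/
def ContainsKtt {V : Type*} (G : SimpleGraph V) (t : ℕ) : Prop :=
  ∃ S T : Finset V, Disjoint S T ∧ S.card = t ∧ T.card = t ∧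
    ∀ s ∈ S, ∀ u ∈ T, G.Adj s u

/-- In a `K_{t,t}`-free graph on vertex set `A ⊎ B` with `|A| ≥ N·2^{N+t}` and
`|B| ≥ N + t` (where `N ≥ t ≥ 1`), there are `A' ⊆ A` and `B' ⊆ B`, each of size at least
`N`, with no edge between `A'` and `B'`. -/
theorem stmt_15 {V : Type*} [Fintype V] (G : SimpleGraph V) (t N : ℕ)
    (ht : 1 ≤ t) (hN : t ≤ N)
    (A B : Set V) (hdisj : Disjoint A B) (hcover : A ∪ B = Set.univ)
    (hfree : ¬ ContainsKtt G t)
    (hA : N * 2 ^ (N + t) ≤ A.ncard) (hB : N + t ≤ B.ncard) :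
    ∃ A' ⊆ A, ∃ B' ⊆ B, N ≤ A'.ncard ∧ N ≤ B'.ncard ∧
      ∀ a ∈ A', ∀ b ∈ B', ¬ G.Adj a b := by
  classical
  obtain ⟨B₀, hB₀, hcard⟩ := Finset.exists_subset_card_eq
    (hB.trans_eq (Set.ncard_eq_toFinset_card' B))
  obtain ⟨S, hS, hfib⟩ := Finset.exists_le_card_fiber_of_mul_le_card_of_maps_to
    (s := A.toFinset) (t := B₀.powerset) (f := fun a => {b ∈ B₀ | G.Adj a b}) (n := N)
    (fun a _ => Finset.mem_powerset.2 (Finset.filter_subset _ _)) ⟨∅, by simp⟩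
    (by rw [Finset.card_powerset, hcard, mul_comm, ← Set.ncard_eq_toFinset_card']; exact hA)
  set F := {a ∈ A.toFinset | {b ∈ B₀ | G.Adj a b} = S} with hF
  have hFA : ∀ a ∈ F, a ∈ A := fun a ha => by
    simpa using (Finset.mem_filter.1 ha).1
  have hadj : ∀ a ∈ F, ∀ b ∈ B₀, (b ∈ S ↔ G.Adj a b) := fun a ha b hb => by
    rw [← (Finset.mem_filter.1 ha).2]
    simp [hb]
  have hBB : ∀ b ∈ B₀, b ∈ B := fun b hb => by simpa using hB₀ hb
  have hSB := Finset.mem_powerset.1 hS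
  have hSt : S.card < t := by
    by_contra! h
    obtain ⟨T, hTS, hT⟩ := Finset.exists_subset_card_eq h
    obtain ⟨R, hRF, hR⟩ := Finset.exists_subset_card_eq (hN.trans hfib)
    refine hfree ⟨R, T, Finset.disjoint_left.2 fun x hx hx' => ?_, hR, hT, fun a ha b hb => ?_⟩
    · exact Set.disjoint_left.1 hdisj (hFA x (hRF hx)) (hBB x (hSB (hTS hx')))
    · exact (hadj a (hRF ha) b (hSB (hTS hb))).1 (hTS hb)
  refine ⟨F, hFA, (B₀ \ S : Finset V), fun b hb => hBB b (Finset.mem_sdiff.1 hb).1, ?_, ?_, ?_⟩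
  · rwa [Set.ncard_coe_finset]
  · rw [Set.ncard_coe_finset, Finset.card_sdiff_of_subset hSB]
    omega
  · intro a ha b hb hab
    obtain ⟨hb₁, hb₂⟩ := Finset.mem_sdiff.1 hb
    exact hb₂ ((hadj a ha b hb₁).2 hab)
end

section
/- For all positive integers k and t there exists an integer M such that the following holds: for every K_{t,t}-free graph G whose vertex set is partitioned into sets A_1, …, A_k each of size at least M, the graph G contains either a clique on k vertices, or an independent set of size k² containing exactly k vertices from each A_i. -/
open Finset in
/-- Finite Ramsey theorem for two colours, inside a finite set of vertices. -/
theorem exists_isNClique_or_isIndepSet_of_le_card (a b : ℕ) :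
    ∃ N : ℕ, ∀ (V : Type) (G : SimpleGraph V) (A : Finset V), N ≤ #A →
      (∃ C ⊆ A, G.IsNClique a C) ∨ ∃ I ⊆ A, #I = b ∧ ∀ u ∈ I, ∀ v ∈ I, ¬ G.Adj u v := by
  classical
  induction a generalizing b with
  | zero => exact ⟨0, fun V G A _ => .inl ⟨∅, by simp, by simp⟩⟩
  | succ a iha =>
    induction b with
    | zero => exact ⟨0, fun V G A _ => .inr ⟨∅, by simp, by simp⟩⟩
    | succ b ihb =>
      obtain ⟨N₁, h₁⟩ := iha (b + 1)
      obtain ⟨N₂, h₂⟩ := ihb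
      refine ⟨N₁ + N₂ + 1, fun V G A hA => ?_⟩
      obtain ⟨v, hv⟩ : A.Nonempty := card_pos.mp (by omega)
      have hcard := card_filter_add_card_filter_not (s := A.erase v) (fun u => G.Adj v u)
      rw [card_erase_of_mem hv] at hcard
      rcases le_or_gt N₁ #{u ∈ A.erase v | G.Adj v u} with h | h
      · rcases h₁ V G _ h with ⟨C, hC, hCl⟩ | ⟨I, hI, hIc, hInd⟩
        · refine .inl ⟨insert v C, ?_, hCl.insert fun u hu => (mem_filter.mp (hC hu)).2⟩
          intro u hu
          rcases mem_insert.mp hu with rfl | hu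
          · exact hv
          · exact mem_of_mem_erase (mem_filter.mp (hC hu)).1
        · exact .inr ⟨I, fun u hu => mem_of_mem_erase (mem_filter.mp (hI hu)).1, hIc, hInd⟩
      · rcases h₂ V G {u ∈ A.erase v | ¬ G.Adj v u} (by omega) with ⟨C, hC, hCl⟩ | ⟨I, hI, hIc, hInd⟩
        · exact .inl ⟨C, fun u hu => mem_of_mem_erase (mem_filter.mp (hC hu)).1, hCl⟩
        · have hvI : v ∉ I := fun hvI => by simpa using hI hvI
          refine .inr ⟨insert v I, ?_, by rw [card_insert_of_notMem hvI, hIc], ?_⟩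
          · intro u hu
            rcases mem_insert.mp hu with rfl | hu
            · exact hv
            · exact mem_of_mem_erase (mem_filter.mp (hI hu)).1
          · intro x hx y hy
            rcases mem_insert.mp hx with rfl | hxI <;> rcases mem_insert.mp hy with rfl | hyI
            · exact G.irrefl
            · exact (mem_filter.mp (hI hyI)).2
            · exact fun h => (mem_filter.mp (hI hxI)).2 h.symm
            · exact hInd x hxI y hyI

open Finset in
/-- Between two large disjoint sets of a `K_{t,t}`-free graph there are large subsets with
no edge between them. -/
theorem exists_subsets_not_adj_of_not_containsKtt {V : Type} {G : SimpleGraph V} {t s : ℕ}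
    (hG : ¬ ContainsKtt G t) {X Y : Finset V} (hXY : Disjoint X Y)
    (hX : t + s ≤ #X) (hY : 2 ^ (t + s) * (t + s) ≤ #Y) :
    ∃ X' ⊆ X, ∃ Y' ⊆ Y, s ≤ #X' ∧ s ≤ #Y' ∧ ∀ x ∈ X', ∀ y ∈ Y', ¬ G.Adj x y := by
  classical
  obtain ⟨X₀, hX₀, hX₀c⟩ := exists_subset_card_eq hX
  obtain ⟨T, hT, hTc⟩ := exists_le_card_fiber_of_mul_le_card_of_maps_to
    (s := Y) (t := X₀.powerset) (f := fun y => {x ∈ X₀ | G.Adj x y}) (n := t + s)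
    (by simp) ⟨∅, by simp⟩ (by rwa [card_powerset, hX₀c])
  have hTX := mem_powerset.mp hT
  have hadj {x y : V} (hx : x ∈ X₀) (hy : y ∈ {y ∈ Y | {x ∈ X₀ | G.Adj x y} = T}) :
      x ∈ T ↔ G.Adj x y := by
    rw [← (mem_filter.mp hy).2]
    simp [hx]
  rcases le_or_gt t #T with h | h
  · obtain ⟨S, hS, hSc⟩ := exists_subset_card_eq h
    obtain ⟨U, hU, hUc⟩ := exists_subset_card_eq ((Nat.le_add_right t s).trans hTc)
    refine (hG ⟨S, U, ?_, hSc, hUc, fun x hx y hy =>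
      (hadj (hTX (hS hx)) (hU hy)).mp (hS hx)⟩).elim
    exact hXY.mono ((hS.trans hTX).trans hX₀) (hU.trans (filter_subset _ _))
  · refine ⟨X₀ \ T, sdiff_subset.trans hX₀, _, filter_subset _ _, ?_,
      (Nat.le_add_left s t).trans hTc, fun x hx y hy hxy => ?_⟩
    · rw [card_sdiff_of_subset hTX]
      omega
    · exact (mem_sdiff.mp hx).2 ((hadj (mem_sdiff.mp hx).1 hy).mpr hxy)

open Finset in
/-- A family of large disjoint sets in a `K_{t,t}`-free graph can be shrunk to a family of large
sets having no edge between any of the listed pairs. -/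
theorem exists_subfamily_not_adj_of_not_containsKtt {ι : Type} (t s : ℕ) (L : List (ι × ι)) :
    ∃ N : ℕ, ∀ (V : Type) (G : SimpleGraph V) (A : ι → Finset V),
      (∀ i j, i ≠ j → Disjoint (A i) (A j)) → (∀ i, N ≤ #(A i)) → ¬ ContainsKtt G t →
      ∃ B : ι → Finset V, (∀ i, B i ⊆ A i) ∧ (∀ i, s ≤ #(B i)) ∧
        ∀ p ∈ L, p.1 ≠ p.2 → ∀ x ∈ B p.1, ∀ y ∈ B p.2, ¬ G.Adj x y := by
  classical
  induction L generalizing s with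
  | nil => exact ⟨s, fun V G A _ hA _ => ⟨A, fun _ => subset_rfl, hA, by simp⟩⟩
  | cons p L ih =>
    obtain ⟨N, hN⟩ := ih (2 ^ (t + s) * (t + s))
    refine ⟨N, fun V G A hdisj hA hG => ?_⟩
    obtain ⟨B, hBA, hBc, hB⟩ := hN V G A hdisj hA hG
    have hle : t + s ≤ 2 ^ (t + s) * (t + s) := Nat.le_mul_of_pos_left _ (by positivity)
    have hBs i : s ≤ #(B i) := by have := hBc i; omega
    by_cases hp : p.1 = p.2
    · refine ⟨B, hBA, hBs, fun q hq hne => ?_⟩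
      rcases List.mem_cons.mp hq with rfl | hq
      · exact (hne hp).elim
      · exact hB q hq hne
    obtain ⟨X, hX, Y, hY, hXc, hYc, hXY⟩ := exists_subsets_not_adj_of_not_containsKtt hG
      ((hdisj _ _ hp).mono (hBA p.1) (hBA p.2)) (hle.trans (hBc p.1)) (hBc p.2)
    let B' := Function.update (Function.update B p.1 X) p.2 Y
    have hB'₂ : B' p.2 = Y := by simp [B']
    have hB'₁ : B' p.1 = X := by simp [B', hp]
    have hB' i (h₁ : i ≠ p.1) (h₂ : i ≠ p.2) : B' i = B i := by simp [B', h₁, h₂]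
    have hsub i : B' i ⊆ B i := by
      by_cases h₂ : i = p.2
      · rwa [h₂, hB'₂]
      by_cases h₁ : i = p.1
      · rwa [h₁, hB'₁]
      rw [hB' i h₁ h₂]
    refine ⟨B', fun i => (hsub i).trans (hBA i), fun i => ?_, fun q hq hne => ?_⟩
    · by_cases h₂ : i = p.2
      · rwa [h₂, hB'₂]
      by_cases h₁ : i = p.1
      · rwa [h₁, hB'₁]
      rw [hB' i h₁ h₂]
      exact hBs i
    · rcases List.mem_cons.mp hq with rfl | hq
      · rwa [hB'₁, hB'₂]
      · exact fun x hx y hy => hB q hq hne x (hsub _ hx) y (hsub _ hy)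

/-- For all `k, t ≥ 1` there is an `M` such that every `K_{t,t}`-free graph whose vertex
set is partitioned into `k` sets each of size at least `M` contains either a clique on `k`
vertices, or an independent set of size `k²` with exactly `k` vertices in each part. -/
theorem stmt_16 (k t : ℕ) (hk : 1 ≤ k) (ht : 1 ≤ t) :
    ∃ M : ℕ, ∀ (V : Type) [Fintype V] (G : SimpleGraph V) (A : Fin k → Set V),
      (∀ i j, i ≠ j → Disjoint (A i) (A j)) →
      (⋃ i, A i) = Set.univ →
      (∀ i, M ≤ (A i).ncard) →
      ¬ ContainsKtt G t →
      (∃ C : Finset V, G.IsNClique k C) ∨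
        (∃ I : Set V, (∀ u ∈ I, ∀ v ∈ I, u ≠ v → ¬ G.Adj u v) ∧
          I.ncard = k ^ 2 ∧ ∀ i, (I ∩ A i).ncard = k) := by
  classical
  obtain ⟨N, hN⟩ := exists_subfamily_not_adj_of_not_containsKtt t k
    (Finset.univ : Finset (Fin k × Fin k)).toList
  obtain ⟨M, hM⟩ := exists_isNClique_or_isIndepSet_of_le_card k N
  refine ⟨M, fun V _ G A hdisj _ hA hG => or_iff_not_imp_left.mpr fun hC => ?_⟩
  have hindep i : ∃ I : Finset V, ↑I ⊆ A i ∧ I.card = N ∧ ∀ u ∈ I, ∀ v ∈ I, ¬ G.Adj u v := by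
    rcases hM V G (A i).toFinset (by rw [← Set.ncard_eq_toFinset_card']; exact hA i) with
      ⟨C, -, hCl⟩ | ⟨I, hI, hIc, hInd⟩
    · exact (hC ⟨C, hCl⟩).elim
    · exact ⟨I, by simpa using hI, hIc, hInd⟩
  choose I hIA hIc hInd using hindep
  have hIdisj i j (hij : i ≠ j) : Disjoint (I i) (I j) :=
    Finset.disjoint_coe.mp ((hdisj i j hij).mono (hIA i) (hIA j))
  obtain ⟨B, hBI, hBc, hB⟩ := hN V G I hIdisj (fun i => (hIc i).ge) hG
  choose J hJB hJc using fun i => Finset.exists_subset_card_eq (hBc i)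
  have hJI i : J i ⊆ I i := (hJB i).trans (hBI i)
  have hJA i : ↑(J i) ⊆ A i := (Finset.coe_subset.mpr (hJI i)).trans (hIA i)
  refine ⟨↑(Finset.univ.biUnion J), fun u hu v hv _ => ?_, ?_, fun i => ?_⟩
  · obtain ⟨i, -, hu⟩ := Finset.mem_biUnion.mp hu
    obtain ⟨j, -, hv⟩ := Finset.mem_biUnion.mp hv
    by_cases hij : i = j
    · subst hij
      exact hInd i u (hJI i hu) v (hJI i hv)
    · exact hB (i, j) (by simp) hij u (hJB i hu) v (hJB j hv)
  · rw [Set.ncard_coe_finset, Finset.card_biUnion fun i _ j _ hij =>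
      (hIdisj i j hij).mono (hJI i) (hJI j)]
    simp [hJc, sq]
  · have : ↑(Finset.univ.biUnion J) ∩ A i = ↑(J i) := by
      ext x
      simp only [Finset.coe_biUnion, Set.mem_inter_iff, Set.mem_iUnion, Finset.mem_coe,
        Finset.mem_univ, exists_prop, true_and]
      refine ⟨fun ⟨⟨j, hj⟩, hx⟩ => ?_, fun hx => ⟨⟨i, hx⟩, hJA i hx⟩⟩
      by_cases hij : j = i
      · exact hij ▸ hj
      · exact (Set.disjoint_left.mp (hdisj j i hij) (hJA j hj) hx).elim
    rw [this, Set.ncard_coe_finset, hJc]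
end

section
/- For all positive integers t and k there exist integers f(t,k) and g(t,k) such that the following holds: let G be a K_{t,t}-free graph whose vertex set is partitioned into X ⊎ Y, with |X| ≥ f(t,k) and |N_G(x) ∩ Y| ≥ g(t,k) for every x ∈ X. Then G contains kK_{1,k} as an induced subgraph; that is, there exist k vertex-disjoint, pairwise non-adjacent induced stars in G, each consisting of a center adjacent to k leaves with the leaves pairwise non-adjacent. -/
/-- Every colouring of a long interval has a large subset on which the colour of an increasing
pair depends only on its smaller element. -/
theorem exists_min_homogeneous (C : Type*) [Finite C] (m : ℕ) :
    ∃ N : ℕ, ∀ (c : ℕ → ℕ → C) (S : Finset ℕ), N ≤ S.card →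
      ∃ T ⊆ S, T.card = m ∧ ∃ f : ℕ → C, ∀ a ∈ T, ∀ b ∈ T, a < b → c a b = f a := by
  classical
  have := Fintype.ofFinite C
  induction m with
  | zero =>
    exact ⟨0, fun c S _ => ⟨∅, by simp, by simp, fun a => c a a, by simp⟩⟩
  | succ m ih =>
    obtain ⟨N, hN⟩ := ih
    refine ⟨Fintype.card C * N + 1, fun c S hS => ?_⟩
    have hne : S.Nonempty := Finset.card_pos.1 (by omega)
    set a := S.min' hne with ha
    have haS : a ∈ S := S.min'_mem hne
    have hcard : (Finset.univ : Finset C).card * N ≤ (S.erase a).card := by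
      rw [Finset.card_erase_of_mem haS, Finset.card_univ]; omega
    obtain ⟨y, -, hy⟩ := Finset.exists_le_card_fiber_of_mul_le_card_of_maps_to
      (f := fun b => c a b) (fun b _ => Finset.mem_univ _) ⟨c a a, Finset.mem_univ _⟩ hcard
    obtain ⟨T, hTS, hT, f, hf⟩ := hN c _ hy
    have hT' : ∀ b ∈ T, b ∈ S ∧ b ≠ a ∧ c a b = y := fun b hb => by
      have := hTS hb
      simp only [Finset.mem_filter, Finset.mem_erase] at this
      tauto
    have haT : a ∉ T := fun h => (hT' a h).2.1 rfl
    refine ⟨insert a T, ?_, by rw [Finset.card_insert_of_notMem haT, hT],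
      Function.update f a y, ?_⟩
    · intro b hb
      rcases Finset.mem_insert.1 hb with rfl | hb
      · exact haS
      · exact (hT' b hb).1
    · intro p hp q hq hpq
      have hmin : ∀ b ∈ T, a ≤ b := fun b hb => S.min'_le b (hT' b hb).1
      rcases Finset.mem_insert.1 hp with hpa | hp
      · rcases Finset.mem_insert.1 hq with hqa | hq
        · omega
        · rw [hpa, Function.update_self]
          exact (hT' q hq).2.2
      · rcases Finset.mem_insert.1 hq with hqa | hq
        · have := hmin p hp
          omega
        · rw [Function.update_of_ne (hT' p hp).2.1]
          exact hf p hp q hq hpq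

/-- Ramsey's theorem for pairs and finitely many colours. -/
theorem exists_ramsey (C : Type*) [Finite C] (n : ℕ) :
    ∃ N : ℕ, ∀ c : Fin N → Fin N → C,
      ∃ e : Fin n ↪o Fin N, ∀ a b a' b', a < b → a' < b' →
        c (e a) (e b) = c (e a') (e b') := by
  classical
  have := Fintype.ofFinite C
  obtain ⟨N, hN⟩ := exists_min_homogeneous C (Fintype.card C * n + 1)
  refine ⟨N + 1, fun c => ?_⟩
  obtain ⟨T, hTS, hT, f, hf⟩ := hN (fun a b => c (Fin.ofNat _ a) (Fin.ofNat _ b))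
    (Finset.range (N + 1)) (by simp)
  obtain ⟨y, -, hy⟩ := Finset.exists_le_card_fiber_of_mul_le_card_of_maps_to (s := T)
    (n := n) (f := f) (t := Finset.univ) (fun b _ => Finset.mem_univ _)
    ⟨f 0, Finset.mem_univ _⟩ (by rw [Finset.card_univ]; omega)
  obtain ⟨H, hHT, hH⟩ := Finset.exists_subset_card_eq hy
  have hmem : ∀ i, H.orderEmbOfFin hH i ∈ T ∧ f (H.orderEmbOfFin hH i) = y := fun i =>
    Finset.mem_filter.1 (hHT (H.orderEmbOfFin_mem hH i))
  have hlt : ∀ i, H.orderEmbOfFin hH i < N + 1 := fun i =>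
    Finset.mem_range.1 (hTS (hmem i).1)
  have hval : ∀ i, (⟨H.orderEmbOfFin hH i, hlt i⟩ : Fin (N + 1)) =
      Fin.ofNat (N + 1) (H.orderEmbOfFin hH i) := fun i => by
    ext; simp [Nat.mod_eq_of_lt (hlt i)]
  have hc : ∀ a b, a < b → c ⟨H.orderEmbOfFin hH a, hlt a⟩ ⟨H.orderEmbOfFin hH b, hlt b⟩ = y :=
    fun a b hab => by
      rw [hval, hval, ← (hmem a).2]
      exact hf _ (hmem a).1 _ (hmem b).1 ((H.orderEmbOfFin hH).lt_iff_lt.2 hab)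
  refine ⟨OrderEmbedding.ofStrictMono (fun i => ⟨H.orderEmbOfFin hH i, hlt i⟩)
    fun a b hab => (H.orderEmbOfFin hH).lt_iff_lt.2 hab, fun a b a' b' h h' => ?_⟩
  exact (hc a b h).trans (hc a' b' h').symm

/-- A long half graph contains `K_{t,t}`. -/
theorem containsKtt_of_half_graph {V : Type*} {G : SimpleGraph V} {t n : ℕ} (hn : 2 * t ≤ n)
    {u v : Fin n → V} (hu : Function.Injective u) (hv : Function.Injective v)
    (h : ∀ a b, a < b → G.Adj (u a) (v b)) : ContainsKtt G t := by
  classical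
  have hadj : ∀ i j : Fin t, G.Adj (u ⟨i, by omega⟩) (v ⟨t + j, by omega⟩) := fun i j =>
    h _ _ (Fin.lt_def.2 (by simp only; omega))
  refine ⟨Finset.univ.image fun i : Fin t => u ⟨i, by omega⟩,
    Finset.univ.image fun j : Fin t => v ⟨t + j, by omega⟩, ?_, ?_, ?_, ?_⟩
  · rw [Finset.disjoint_left]
    intro x hx hx'
    obtain ⟨i, -, rfl⟩ := Finset.mem_image.1 hx
    obtain ⟨j, -, hj⟩ := Finset.mem_image.1 hx'
    exact (hadj i j).ne hj.symm
  · rw [Finset.card_image_of_injective, Finset.card_fin]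
    intro i j hij
    have := hu hij
    simp only [Fin.mk.injEq] at this
    exact Fin.ext this
  · rw [Finset.card_image_of_injective, Finset.card_fin]
    intro i j hij
    have := hv hij
    simp only [Fin.mk.injEq] at this
    exact Fin.ext (by omega)
  · intro s hs w hw
    obtain ⟨i, -, rfl⟩ := Finset.mem_image.1 hs
    obtain ⟨j, -, rfl⟩ := Finset.mem_image.1 hw
    exact hadj i j

/-- Two finite, completely joined sets of size at least `t` yield `K_{t,t}`. -/
theorem containsKtt_of_le_card {V : Type*} {G : SimpleGraph V} {t : ℕ} {S T : Finset V}
    (hS : t ≤ S.card) (hT : t ≤ T.card) (h : ∀ s ∈ S, ∀ u ∈ T, G.Adj s u) :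
    ContainsKtt G t := by
  obtain ⟨S', hS', hSc⟩ := Finset.exists_subset_card_eq hS
  obtain ⟨T', hT', hTc⟩ := Finset.exists_subset_card_eq hT
  refine ⟨S', T', ?_, hSc, hTc, fun s hs u hu => h s (hS' hs) u (hT' hu)⟩
  exact Finset.disjoint_left.2 fun x hx hx' => (h x (hS' hx) x (hT' hx')).ne rfl

/-- In a `K_{t,t}`-free graph, finitely many vertices with many neighbours in `Y` each have many
neighbours in `Y` that see the same fewer than `t` of these vertices. -/
theorem exists_uniform_neighbors {V : Type*} [Finite V] {G : SimpleGraph V} {t M n : ℕ}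
    {Y : Set V} (hG : ¬ ContainsKtt G t) (htn : t ≤ n) (x : Fin M ↪ V) (s : Fin M)
    (hs : 2 ^ M * n ≤ (G.neighborSet (x s) ∩ Y).ncard) :
    ∃ (T : Finset (Fin M)) (A : Finset V), s ∈ T ∧ T.card < t ∧ n ≤ A.card ∧
      (∀ y ∈ A, y ∈ Y) ∧ ∀ y ∈ A, ∀ r, G.Adj (x r) y ↔ r ∈ T := by
  classical
  have := Fintype.ofFinite V
  rw [Set.ncard_eq_toFinset_card'] at hs
  obtain ⟨T, hT, hTn⟩ := Finset.exists_le_card_fiber_of_mul_le_card_of_maps_to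
    (s := (G.neighborSet (x s) ∩ Y).toFinset) (n := n)
    (f := fun y => Finset.univ.filter fun r => G.Adj (x r) y)
    (t := Finset.univ.filter fun T : Finset (Fin M) => s ∈ T)
    (fun y hy => by
      simp only [Set.mem_toFinset, Set.mem_inter_iff, SimpleGraph.mem_neighborSet] at hy
      simpa using hy.1)
    ⟨{s}, by simp⟩
    (le_trans (Nat.mul_le_mul_right n (by
      refine (Finset.card_filter_le _ _).trans ?_
      simp)) hs)
  refine ⟨T, _, (Finset.mem_filter.1 hT).2, ?_, hTn, ?_, ?_⟩
  · by_contra! hlt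
    refine hG (containsKtt_of_le_card (S := T.map x) (by rwa [Finset.card_map])
      (htn.trans hTn) ?_)
    intro a ha y hy
    obtain ⟨r, hr, rfl⟩ := Finset.mem_map.1 ha
    rw [← (Finset.mem_filter.1 hy).2] at hr
    exact (Finset.mem_filter.1 hr).2
  · intro y hy
    have := (Finset.mem_filter.1 hy).1
    rw [Set.mem_toFinset] at this
    exact this.2
  · intro y hy r
    rw [← (Finset.mem_filter.1 hy).2]
    simp

/-- Many vertices, each with a set of fewer than `t` vertices attached, contain a large
independent set that is also independent for the attached sets, when `G` is `K_{t,t}`-free. -/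
theorem exists_independent_family (t k : ℕ) :
    ∃ M : ℕ, ∀ (V : Type) (G : SimpleGraph V) (x : Fin M ↪ V) (T : Fin M → Finset (Fin M)),
      ¬ ContainsKtt G t → (∀ s, (T s).card < t) →
      ∃ e : Fin k ↪ Fin M, ∀ i j, i ≠ j → ¬ G.Adj (x (e i)) (x (e j)) ∧ e j ∉ T (e i) := by
  classical
  obtain ⟨M, hM⟩ := exists_ramsey (Prop × Prop × Prop) (2 * t + k + 2)
  refine ⟨M, fun V G x T hG hT => ?_⟩
  obtain ⟨e, he⟩ := hM fun r s => (G.Adj (x r) (x s), s ∈ T r, r ∈ T s)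
  simp only [Prod.mk.injEq, eq_iff_iff] at he
  have h_adj : ∀ a b, a < b → ¬ G.Adj (x (e a)) (x (e b)) := fun a b hab h =>
    hG (containsKtt_of_half_graph (n := 2 * t + k + 2) (by omega)
      (x.injective.comp e.injective) (x.injective.comp e.injective)
      fun a' b' hab' => (he a b a' b' hab hab').1.1 h)
  have h_right : ∀ a b, a < b → e b ∉ T (e a) := fun a b hab h => by
    have hsub : (Finset.Ioi (0 : Fin (2 * t + k + 2))).map e.toEmbedding ⊆ T (e 0) := by
      intro r hr
      obtain ⟨c, hc, rfl⟩ := Finset.mem_map.1 hr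
      exact (he a b 0 c hab (Finset.mem_Ioi.1 hc)).2.1.1 h
    have := Finset.card_le_card hsub
    have := hT (e 0)
    rw [Finset.card_map, Fin.card_Ioi] at *
    simp only [Fin.val_zero] at *
    omega
  have h_left : ∀ a b, a < b → e a ∉ T (e b) := fun a b hab h => by
    have hsub : (Finset.Iio (Fin.last (2 * t + k + 1))).map e.toEmbedding ⊆
        T (e (Fin.last _)) := by
      intro r hr
      obtain ⟨c, hc, rfl⟩ := Finset.mem_map.1 hr
      exact (he a b c (Fin.last _) hab (Finset.mem_Iio.1 hc)).2.2.1 h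
    have := Finset.card_le_card hsub
    have := hT (e (Fin.last _))
    rw [Finset.card_map, Fin.card_Iio] at *
    simp only [Fin.val_last] at *
    omega
  refine ⟨(Fin.castLEEmb (by omega)).trans e.toEmbedding, fun i j hij => ?_⟩
  simp only [Function.Embedding.trans_apply, RelEmbedding.coe_toEmbedding]
  rcases lt_or_gt_of_ne hij with h | h
  · exact ⟨h_adj _ _ h, h_right _ _ h⟩
  · exact ⟨fun h' => h_adj _ _ h h'.symm, h_left _ _ h⟩

/-- From `k` large sets in a `K_{t,t}`-free graph one can pick `k` vertices each, pairwise
non-adjacent. -/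
theorem exists_independent_leaves (t k : ℕ) :
    ∃ N : ℕ, ∀ (V : Type) (G : SimpleGraph V) (l : Fin k → Fin N ↪ V), ¬ ContainsKtt G t →
      ∃ p : Fin k × Fin k ↪ Fin N, ∀ q q', q ≠ q' →
        ¬ G.Adj (l q.1 (p q)) (l q'.1 (p q')) := by
  obtain ⟨N, hN⟩ := exists_ramsey (Fin k → Fin k → Prop) (2 * t + k * k)
  refine ⟨N, fun V G l hG => ?_⟩
  obtain ⟨e, he⟩ := hN fun r s i j => G.Adj (l i r) (l j s)
  have h_adj : ∀ i j a b, a < b → ¬ G.Adj (l i (e a)) (l j (e b)) := fun i j a b hab h =>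
    hG (containsKtt_of_half_graph (n := 2 * t + k * k) (by omega)
      ((l i).injective.comp e.injective) ((l j).injective.comp e.injective)
      fun a' b' hab' => (congrFun (congrFun (he a b a' b' hab hab') i) j).mp h)
  refine ⟨(finProdFinEquiv.toEmbedding.trans (Fin.castLEEmb (by omega))).trans e.toEmbedding,
    fun q q' hq => ?_⟩
  simp only [Function.Embedding.trans_apply, RelEmbedding.coe_toEmbedding]
  rcases lt_or_gt_of_ne (finProdFinEquiv.injective.ne hq) with h | h
  · exact h_adj _ _ _ _ h
  · exact fun h' => h_adj _ _ _ _ h h'.symm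

/-- For all `t, k ≥ 1` there are integers `f` and `g` such that every `K_{t,t}`-free graph
with vertex set partitioned into `X ⊎ Y`, where `|X| ≥ f` and every `x ∈ X` has at least
`g` neighbors in `Y`, contains `k·K_{1,k}` as an induced subgraph: `k` pairwise
non-adjacent induced stars, each with a center `b i` adjacent to `k` pairwise non-adjacent
leaves `L i j`. -/
theorem stmt_17 (t k : ℕ) (ht : 1 ≤ t) (hk : 1 ≤ k) :
    ∃ f g : ℕ, ∀ (V : Type) [Fintype V] (G : SimpleGraph V) (X Y : Set V),
      Disjoint X Y → X ∪ Y = Set.univ → ¬ ContainsKtt G t →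
      f ≤ X.ncard → (∀ x ∈ X, g ≤ (G.neighborSet x ∩ Y).ncard) →
      ∃ (b : Fin k → V) (L : Fin k → Fin k → V),
        Function.Injective (Sum.elim b (fun q : Fin k × Fin k => L q.1 q.2)) ∧
        (∀ i j, G.Adj (b i) (L i j)) ∧
        (∀ i i', i ≠ i' → ¬ G.Adj (b i) (b i')) ∧
        (∀ i i' j, i ≠ i' → ¬ G.Adj (b i) (L i' j)) ∧
        (∀ i j i' j', (i, j) ≠ (i', j') → ¬ G.Adj (L i j) (L i' j')) := by
  classical
  obtain ⟨M, hM⟩ := exists_independent_family t k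
  obtain ⟨N, hN⟩ := exists_independent_leaves t k
  refine ⟨M, 2 ^ M * (N + t), fun V _ G X Y hXY _ hG hX hdeg => ?_⟩
  obtain ⟨X', hX'X, hX'⟩ := Set.exists_subset_card_eq hX
  have hfin := X'.toFinite
  have hcard : hfin.toFinset.card = M := by rw [← Set.ncard_eq_toFinset_card, hX']
  let x : Fin M ↪ V :=
    (hfin.toFinset.equivFinOfCardEq hcard).symm.toEmbedding.trans (Function.Embedding.subtype _)
  have hx : ∀ s, x s ∈ X := fun s =>
    hX'X (hfin.mem_toFinset.1 ((hfin.toFinset.equivFinOfCardEq hcard).symm s).2)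
  choose T A hsT hTt hA hAY hAT using fun s =>
    exists_uniform_neighbors hG (Nat.le_add_left t N) x s (hdeg _ (hx s))
  obtain ⟨e, he⟩ := hM V G x T hG hTt
  have hemb : ∀ i, ∃ l : Fin N ↪ V, ∀ r, l r ∈ A (e i) := fun i => by
    obtain ⟨B, hBA, hB⟩ := Finset.exists_subset_card_eq ((Nat.le_add_right N t).trans (hA (e i)))
    exact ⟨(B.equivFinOfCardEq hB).symm.toEmbedding.trans (Function.Embedding.subtype _),
      fun r => hBA ((B.equivFinOfCardEq hB).symm r).2⟩
  choose l hl using hemb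
  obtain ⟨p, hp⟩ := hN V G l hG
  have hlb : ∀ i i' r, G.Adj (x (e i)) (l i' r) ↔ i = i' := fun i i' r => by
    rw [hAT _ _ (hl i' r)]
    refine ⟨fun h => ?_, fun h => h ▸ hsT _⟩
    by_contra hne
    exact (he i' i (Ne.symm hne)).2 h
  refine ⟨fun i => x (e i), fun i j => l i (p (i, j)), ?_, ?_, ?_, ?_, ?_⟩
  · refine (x.injective.comp e.injective).sumElim ?_ ?_
    · rintro ⟨i, j⟩ ⟨i', j'⟩ h
      simp only at h
      have hii : i = i' := (hlb i i' (p (i', j'))).1 (h ▸ (hlb i i _).2 rfl)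
      subst hii
      exact p.injective ((l i).injective h)
    · intro i q h
      have hY : x (e i) ∈ Y := by
        rw [show x (e i) = l q.1 (p q) from h]
        exact hAY _ _ (hl q.1 _)
      exact Set.disjoint_left.1 hXY (hx (e i)) hY
  · exact fun i j => (hlb _ _ _).2 rfl
  · exact fun i i' h => (he i i' h).1
  · exact fun i i' j h h' => h ((hlb _ _ _).1 h')
  · exact fun i j i' j' h => hp (i, j) (i', j') h
end

section
/- For all positive integers t and k there exists an integer M' such that the following holds for every j ∈ {1, …, k}: let G be a K_{t,t}-free graph whose vertex set is partitioned into X ⊎ Y, with |X| ≥ j·(t·k^t + t) and |N_G(x) ∩ Y| ≥ 2^{j·(t·k^t + t)}·M' for every x ∈ X. Then there exist j distinct vertices b_1, …, b_j ∈ X and pairwise disjoint vertex sets A_1, …, A_j ⊆ Y, each of size at least M', such that for every i ∈ {1, …, j}, every vertex of A_i is adjacent to b_i and non-adjacent to every b_{i'} with i' ≠ i (the sets A_i are private neighborhoods of the b_i). -/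
open Finset in
/-- A digraph with out-degrees at most `d` on at least `j * (2 * d + 1)` vertices has an
independent set of size `j`. -/
theorem exists_independent_of_card_out_le {V : Type*} [DecidableEq V] (f : V → Finset V)
    (d j : ℕ) (X : Finset V) (hf : ∀ x ∈ X, #(f x) ≤ d) (hX : j * (2 * d + 1) ≤ #X) :
    ∃ B ⊆ X, #B = j ∧ ∀ b ∈ B, ∀ c ∈ B, b ≠ c → c ∉ f b := by
  induction j generalizing X with
  | zero => exact ⟨∅, by simp⟩
  | succ j ih =>
    have hne : X.Nonempty := by
      rw [← card_pos]
      nlinarith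
    obtain ⟨x, hx, hin⟩ : ∃ x ∈ X, #{y ∈ X | x ∈ f y} ≤ d := by
      by_contra! h
      have h₁ : ∑ x ∈ X, #{y ∈ X | x ∈ f y} = ∑ y ∈ X, #{x ∈ X | x ∈ f y} :=
        sum_card_bipartiteAbove_eq_sum_card_bipartiteBelow (fun x y => x ∈ f y)
      have h₂ : ∑ y ∈ X, #{x ∈ X | x ∈ f y} ≤ ∑ y ∈ X, d :=
        sum_le_sum fun y hy => (card_le_card fun x hx => (mem_filter.1 hx).2).trans (hf y hy)
      have h₃ : ∑ y ∈ X, d < ∑ x ∈ X, #{y ∈ X | x ∈ f y} := sum_lt_sum_of_nonempty hne h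
      omega
    set R := insert x (f x ∪ {y ∈ X | x ∈ f y}) with hR
    have hRcard : #R ≤ 2 * d + 1 := by
      have h₁ : #R ≤ _ := card_insert_le x (f x ∪ {y ∈ X | x ∈ f y})
      have h₂ := card_union_le (f x) {y ∈ X | x ∈ f y}
      have h₃ := hf x hx
      omega
    obtain ⟨B, hBX, hB, hind⟩ := ih (X \ R) (fun y hy => hf y (mem_sdiff.1 hy).1) (by
      have := le_card_sdiff R X
      rw [Nat.succ_mul] at hX
      omega)
    have hnot : ∀ b ∈ B, b ∈ X ∧ b ≠ x ∧ b ∉ f x ∧ x ∉ f b := by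
      intro b hb
      have := hBX hb
      simp only [hR, mem_sdiff, mem_insert, mem_union, mem_filter] at this
      tauto
    refine ⟨insert x B, ?_, ?_, ?_⟩
    · exact insert_subset hx fun b hb => (hnot b hb).1
    · rw [card_insert_of_notMem fun h => (hnot x h).2.1 rfl, hB]
    · intro b hb c hc hbc
      rcases mem_insert.1 hb with rfl | hbB <;> rcases mem_insert.1 hc with rfl | hcB
      · exact absurd rfl hbc
      · exact (hnot c hcB).2.2.1
      · exact (hnot b hbB).2.2.2
      · exact hind b hbB c hcB hbc

open Finset in
open scoped Classical in
/-- In a `K_{t,t}`-free graph, a vertex with many neighbors in `Y` has at least `M ≥ t` neighbors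
in `Y` with a common trace on `X` of size less than `t`. -/
theorem exists_common_trace {V : Type*} [Fintype V] (G : SimpleGraph V)
    {X Y : Finset V} (hXY : Disjoint X Y) {t M : ℕ} (htM : t ≤ M) (hG : ¬ ContainsKtt G t)
    (x : V) (hx : 2 ^ #X * M ≤ #{y ∈ Y | G.Adj x y}) :
    ∃ S ⊆ X, #S < t ∧ M ≤ #{y ∈ Y | G.Adj x y ∧ {z ∈ X | G.Adj z y} = S} := by
  obtain ⟨S, hS, hM⟩ := exists_le_card_fiber_of_mul_le_card_of_maps_to
    (s := {y ∈ Y | G.Adj x y}) (t := X.powerset) (f := fun y => {z ∈ X | G.Adj z y}) (n := M)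
    (fun y _ => mem_powerset.2 (filter_subset _ _)) (powerset_nonempty X)
    (by rwa [card_powerset])
  rw [filter_filter] at hM
  refine ⟨S, mem_powerset.1 hS, ?_, hM⟩
  by_contra! hle
  obtain ⟨P, hPS, hP⟩ := exists_subset_card_eq hle
  obtain ⟨Q, hQS, hQ⟩ := exists_subset_card_eq (htM.trans hM)
  refine hG ⟨P, Q, ?_, hP, hQ, fun p hp q hq => ?_⟩
  · exact hXY.mono (hPS.trans (mem_powerset.1 hS)) (hQS.trans (filter_subset _ _))
  · have hp' := hPS hp
    rw [← (mem_filter.1 (hQS hq)).2.2] at hp'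
    exact (mem_filter.1 hp').2

/-- Private neighborhoods exist in `K_{t,t}`-free graphs for every size `M ≥ t`. -/
theorem exists_private_neighborhoods {V : Type*} [Fintype V] (G : SimpleGraph V) {X Y : Set V}
    (hXY : Disjoint X Y) {t M j N : ℕ} (htM : t ≤ M) (hN : j * (2 * t) ≤ N)
    (hG : ¬ ContainsKtt G t) (hX : N ≤ X.ncard)
    (hdeg : ∀ x ∈ X, 2 ^ N * M ≤ (G.neighborSet x ∩ Y).ncard) :
    ∃ b : Fin j → V, Function.Injective b ∧ (∀ i, b i ∈ X) ∧
      ∃ A : Fin j → Set V,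
        (∀ i, A i ⊆ Y) ∧
        (∀ i i', i ≠ i' → Disjoint (A i) (A i')) ∧
        (∀ i, M ≤ (A i).ncard) ∧
        (∀ i, ∀ v ∈ A i, G.Adj (b i) v) ∧
        (∀ i i', i ≠ i' → ∀ v ∈ A i, ¬ G.Adj (b i') v) := by
  classical
  rw [Set.ncard_eq_toFinset_card'] at hX
  obtain ⟨X₀, hX₀, hcard⟩ := Finset.exists_subset_card_eq hX
  replace hX₀ : ∀ x ∈ X₀, x ∈ X := fun x hx => Set.mem_toFinset.1 (hX₀ hx)
  have hdisj : Disjoint X₀ Y.toFinset :=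
    Finset.disjoint_left.2 fun x hx hy =>
      Set.disjoint_left.1 hXY (hX₀ x hx) (Set.mem_toFinset.1 hy)
  have htrace : ∀ x : V, ∃ S : Finset V, x ∈ X₀ → S.card < t ∧
      M ≤ ({y ∈ Y.toFinset | G.Adj x y ∧ {z ∈ X₀ | G.Adj z y} = S} : Finset V).card := by
    intro x
    by_cases hx : x ∈ X₀
    · have h := hdeg x (hX₀ x hx)
      have heq : G.neighborSet x ∩ Y = (({y ∈ Y.toFinset | G.Adj x y} : Finset V) : Set V) := by
        ext y
        simp [and_comm]
      rw [heq, Set.ncard_coe_finset, ← hcard] at h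
      obtain ⟨S, -, hS⟩ := exists_common_trace G hdisj htM hG x h
      exact ⟨S, fun _ => hS⟩
    · exact ⟨∅, fun h => absurd h hx⟩
  choose S hS using htrace
  obtain ⟨B, hBX, hB, hind⟩ := exists_independent_of_card_out_le S (t - 1) j X₀
    (fun x hx => Nat.le_sub_one_of_lt (hS x hx).1) (by
      rcases Nat.eq_zero_or_pos t with rfl | ht
      · exact absurd ⟨∅, ∅, by simp⟩ hG
      · rw [hcard]
        exact (Nat.mul_le_mul_left j (by omega)).trans hN)
  let e := (B.equivFinOfCardEq hB).symm
  let A : Fin j → Finset V := fun i =>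
    {y ∈ Y.toFinset | G.Adj (e i) y ∧ {z ∈ X₀ | G.Adj z y} = S (e i)}
  have hb : ∀ i, (e i : V) ∈ X₀ := fun i => hBX (e i).2
  have hinj : Function.Injective fun i => (e i : V) := Subtype.val_injective.comp e.injective
  have hadj : ∀ i, ∀ v ∈ A i, G.Adj (e i) v := fun i v hv => (Finset.mem_filter.1 hv).2.1
  have hnadj : ∀ i i', i ≠ i' → ∀ v ∈ A i, ¬ G.Adj (e i') v := by
    intro i i' hne v hv h
    refine hind _ (e i).2 _ (e i').2 (hinj.ne hne) ?_
    rw [← (Finset.mem_filter.1 hv).2.2]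
    exact Finset.mem_filter.2 ⟨hb i', h⟩
  refine ⟨fun i => e i, hinj, fun i => hX₀ _ (hb i), fun i => A i, ?_, ?_, ?_, hadj, hnadj⟩
  · exact fun i v hv => Set.mem_toFinset.1 (Finset.mem_filter.1 hv).1
  · exact fun i i' hne => Set.disjoint_left.2 fun v hv hv' => hnadj i i' hne v hv (hadj i' v hv')
  · intro i
    rw [Set.ncard_coe_finset]
    exact (hS _ (hb i)).2

/-- For all `t, k ≥ 1` there is an `M'` such that for every `j ∈ {1, …, k}`: in every
`K_{t,t}`-free graph with vertex set partitioned into `X ⊎ Y`, where `|X| ≥ j·(t·k^t + t)`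
and every `x ∈ X` has at least `2^{j·(t·k^t + t)}·M'` neighbors in `Y`, there are `j`
distinct vertices `b 1, …, b j ∈ X` and pairwise disjoint sets `A 1, …, A j ⊆ Y`, each of
size at least `M'`, such that the vertices of `A i` are adjacent to `b i` and to no other
`b i'`. -/
theorem stmt_18 (t k : ℕ) (ht : 1 ≤ t) (hk : 1 ≤ k) :
    ∃ M' : ℕ, ∀ j, 1 ≤ j → j ≤ k →
      ∀ (V : Type) [Fintype V] (G : SimpleGraph V) (X Y : Set V),
        Disjoint X Y → X ∪ Y = Set.univ → ¬ ContainsKtt G t →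
        j * (t * k ^ t + t) ≤ X.ncard →
        (∀ x ∈ X, 2 ^ (j * (t * k ^ t + t)) * M' ≤ (G.neighborSet x ∩ Y).ncard) →
        ∃ b : Fin j → V, Function.Injective b ∧ (∀ i, b i ∈ X) ∧
          ∃ A : Fin j → Set V,
            (∀ i, A i ⊆ Y) ∧
            (∀ i i', i ≠ i' → Disjoint (A i) (A i')) ∧
            (∀ i, M' ≤ (A i).ncard) ∧
            (∀ i, ∀ v ∈ A i, G.Adj (b i) v) ∧
            (∀ i i', i ≠ i' → ∀ v ∈ A i, ¬ G.Adj (b i') v) := by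
  refine ⟨t, fun j _ _ V _ G X Y hXY _ hG hX hdeg => ?_⟩
  refine exists_private_neighborhoods G hXY le_rfl (Nat.mul_le_mul_left j ?_) hG hX hdeg
  have := Nat.le_mul_of_pos_right t (Nat.pow_pos (n := t) hk)
  omega
end
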